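/- arXiv:2306.05184 — 3 statements merged into one kernel-verified Lean document; each statement's English description precedes it below -/
import Mathlib

section
/- Let n ≥ 4. There exist constants ε₀ > 0 and C > 0 depending only on n such that: for every smooth vector field f : ℝⁿ → ℝⁿ supported in the ball B₃ with ‖f‖_{L^∞} ≤ ε₀, there exist a smooth vector field w : ℝⁿ → ℝⁿ and a smooth function q : ℝⁿ → ℝ satisfying −Δw + (w·∇)w + ∇q = f and div w = 0 on all of ℝⁿ, together with the pointwise bound |w(x)| ≤ C ε₀ (1 + |x|)^{2−n} for all x ∈ ℝⁿ. -/
open MeasureTheory Filter Topology BoundedContinuousFunction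

/-- The reference decay rate `(1 + |x|)^{-(n+1)}`, integrable on `ℝⁿ`. -/
noncomputable def decay {n : ℕ} (x : EuclideanSpace ℝ (Fin n)) : ℝ := ((1 + ‖x‖) ^ (n + 1))⁻¹

lemma decay_pos {n : ℕ} (x : EuclideanSpace ℝ (Fin n)) : 0 < decay x := by
  unfold decay; positivity

lemma continuous_decay {n : ℕ} :
    Continuous (decay : EuclideanSpace ℝ (Fin n) → ℝ) := by
  unfold decay
  exact Continuous.inv₀ (by fun_prop) fun x => by positivity

lemma integrable_decay {n : ℕ} :
    Integrable (decay : EuclideanSpace ℝ (Fin n) → ℝ) := by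
  have h := integrable_one_add_norm (E := EuclideanSpace ℝ (Fin n)) (μ := volume)
    (r := ((n + 1 : ℕ) : ℝ)) (by simp)
  refine h.congr (Eventually.of_forall fun x => ?_)
  simp only [decay]
  rw [Real.rpow_neg (by positivity), Real.rpow_natCast]

lemma decay_sub_le {n : ℕ} (x y : EuclideanSpace ℝ (Fin n)) :
    decay (x - y) ≤ (1 + ‖x‖) ^ (n + 1) * decay y := by
  unfold decay
  rw [← div_eq_mul_inv, inv_eq_one_div, div_le_div_iff₀ (by positivity) (by positivity), one_mul,
    ← mul_pow]
  have : ‖y‖ ≤ ‖x‖ + ‖x - y‖ := by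
    have := norm_sub_le x (x - y); simpa using this
  gcongr
  nlinarith [norm_nonneg x, norm_nonneg (x - y)]

/-- An integrable majorant on `ℝⁿ` with a singularity `|x|^{-s}` at the origin. -/
noncomputable def singMajorant {n : ℕ} (s : ℕ) (y : EuclideanSpace ℝ (Fin n)) : ℝ :=
  (‖y‖ ^ s)⁻¹ * ((1 + ‖y‖) ^ (n + 1 - s))⁻¹

lemma singMajorant_nonneg {n : ℕ} (s : ℕ) (y : EuclideanSpace ℝ (Fin n)) :
    0 ≤ singMajorant s y := by unfold singMajorant; positivity

lemma integrable_singMajorant {n s : ℕ} (hs : s + 1 ≤ n) :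
    Integrable (singMajorant s : EuclideanSpace ℝ (Fin n) → ℝ) := by
  have : Nontrivial (EuclideanSpace ℝ (Fin n)) := by
    have : Nonempty (Fin n) := ⟨⟨0, by omega⟩⟩
    infer_instance
  have h := integrable_fun_norm_addHaar (volume : Measure (EuclideanSpace ℝ (Fin n)))
    (f := fun t : ℝ => (t ^ s)⁻¹ * ((1 + t) ^ (n + 1 - s))⁻¹)
  refine h.2 ?_
  have h1 : IntegrableOn (fun t : ℝ => (1 + ‖t‖) ^ (-2 : ℝ)) (Set.Ioi 0) :=
    (integrable_one_add_norm (E := ℝ) (μ := volume) (r := 2) (by simp)).integrableOn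
  refine Integrable.mono' h1 ?_ ?_
  · exact Measurable.aestronglyMeasurable (by fun_prop)
  · refine (ae_restrict_iff' measurableSet_Ioi).2 (Eventually.of_forall fun t ht => ?_)
    have ht : 0 < t := ht
    obtain ⟨m, rfl⟩ : ∃ m, n = s + 1 + m := ⟨n - (s + 1), by omega⟩
    have e1 : s + 1 + m - 1 = s + m := by omega
    have e2 : s + 1 + m + 1 - s = m + 2 := by omega
    simp only [finrank_euclideanSpace, Fintype.card_fin, smul_eq_mul, e1, e2]
    rw [Real.norm_of_nonneg (by positivity), Real.norm_of_nonneg ht.le,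
      Real.rpow_neg (by positivity), pow_add, pow_add]
    have : t ^ m ≤ (1 + t) ^ m := by gcongr; linarith
    norm_num
    field_simp
    exact this

lemma inv_norm_pow_mul_decay_sub_le {n s : ℕ} (hs : s + 1 ≤ n)
    (x y : EuclideanSpace ℝ (Fin n)) :
    (‖y‖ ^ s)⁻¹ * decay (x - y) ≤ (1 + ‖x‖) ^ (n + 1) * singMajorant s y := by
  have h1 := decay_sub_le x y
  have h2 : decay y ≤ ((1 + ‖y‖) ^ (n + 1 - s))⁻¹ := by
    unfold decay
    gcongr
    · linarith [norm_nonneg y]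
    · omega
  calc (‖y‖ ^ s)⁻¹ * decay (x - y) ≤ (‖y‖ ^ s)⁻¹ * ((1 + ‖x‖) ^ (n + 1) *
        ((1 + ‖y‖) ^ (n + 1 - s))⁻¹) := by gcongr; exact h1.trans (by gcongr)
    _ = _ := by unfold singMajorant; ring

lemma weighted_singular_le {n s : ℕ} (hs : s + 1 ≤ n)
    (x y : EuclideanSpace ℝ (Fin n)) (hy : y ≠ 0) :
    (1 + ‖x‖) ^ s * ((‖y‖ ^ s)⁻¹ * decay (x - y)) ≤
      3 ^ s * decay (x - y) + 2 ^ (n + 1) * singMajorant s y := by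
  have hy' : 0 < ‖y‖ := norm_pos_iff.2 hy
  have htri : ‖x‖ ≤ ‖y‖ + ‖x - y‖ := by
    have := norm_add_le y (x - y); simpa using this
  have hd := decay_pos (x - y)
  have hm := singMajorant_nonneg s y
  by_cases h : ‖y‖ ≤ ‖x - y‖ ∨ ‖y‖ ≤ 1
  · refine le_trans ?_ (le_add_of_nonneg_left (by positivity))
    obtain ⟨m, hm⟩ : ∃ m, n + 1 = s + m := ⟨n + 1 - s, by omega⟩
    have e : n + 1 - s = m := by omega
    have b1 : 1 + ‖x‖ ≤ 2 * (1 + ‖x - y‖) := by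
      rcases h with h | h <;> nlinarith [norm_nonneg (x - y)]
    have b2 : 1 + ‖y‖ ≤ 2 * (1 + ‖x - y‖) := by
      rcases h with h | h <;> nlinarith [norm_nonneg (x - y)]
    unfold singMajorant decay
    rw [e, hm]
    have c1 : (1 + ‖x‖) ^ s ≤ 2 ^ s * (1 + ‖x - y‖) ^ s := by rw [← mul_pow]; gcongr
    have c2 : (1 + ‖y‖) ^ m ≤ 2 ^ m * (1 + ‖x - y‖) ^ m := by rw [← mul_pow]; gcongr
    have : (1 + ‖x‖) ^ s * (1 + ‖y‖) ^ m ≤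
        2 ^ s * (1 + ‖x - y‖) ^ s * (2 ^ m * (1 + ‖x - y‖) ^ m) := by gcongr
    rw [pow_add, pow_add, ← sub_nonneg]
    have e2 : 2 ^ s * 2 ^ m * ((‖y‖ ^ s)⁻¹ * ((1 + ‖y‖) ^ m)⁻¹) -
        (1 + ‖x‖) ^ s * ((‖y‖ ^ s)⁻¹ * ((1 + ‖x - y‖) ^ s * (1 + ‖x - y‖) ^ m)⁻¹) =
        (2 ^ s * (1 + ‖x - y‖) ^ s * (2 ^ m * (1 + ‖x - y‖) ^ m) -
          (1 + ‖x‖) ^ s * (1 + ‖y‖) ^ m) * ((‖y‖ ^ s)⁻¹ * ((1 + ‖y‖) ^ m)⁻¹ *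
          ((1 + ‖x - y‖) ^ s * (1 + ‖x - y‖) ^ m)⁻¹) := by
      field_simp
    rw [e2]
    exact mul_nonneg (sub_nonneg.2 this) (by positivity)
  · push Not at h
    refine le_trans ?_ (le_add_of_nonneg_right (by positivity))
    rw [← mul_assoc]
    gcongr
    rw [← div_eq_mul_inv, div_le_iff₀ (by positivity), ← mul_pow]
    gcongr
    linarith

/-- A kernel with a singularity of order at most `s` at the origin and decay of order at least
`s` at infinity. -/
structure SingKernel {n : ℕ} (s : ℕ) (A : ℝ) (K : EuclideanSpace ℝ (Fin n) → ℝ) : Prop where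
  nonneg : 0 ≤ A
  meas : Measurable K
  bound : ∀ y, y ≠ 0 → |K y| ≤ A * (‖y‖ ^ s)⁻¹

/-- Convolution of real functions on `ℝⁿ`. -/
noncomputable def conv {n : ℕ} (K F : EuclideanSpace ℝ (Fin n) → ℝ)
    (x : EuclideanSpace ℝ (Fin n)) : ℝ := ∫ y, K y * F (x - y)

lemma ae_ne_zero {n : ℕ} (hn : 1 ≤ n) :
    ∀ᵐ y : EuclideanSpace ℝ (Fin n), y ≠ 0 := by
  have : Nonempty (Fin n) := ⟨⟨0, by omega⟩⟩
  exact compl_mem_ae_iff.2 (measure_singleton 0)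

/-- Continuous functions with decay `O((1 + |x|)^{-(n+1)})`. -/
structure Decays {n : ℕ} (B : ℝ) (F : EuclideanSpace ℝ (Fin n) → ℝ) : Prop where
  cont : Continuous F
  bound : ∀ x, |F x| ≤ B * decay x

lemma Decays.nonneg {n : ℕ} {B : ℝ} {F : EuclideanSpace ℝ (Fin n) → ℝ} (hF : Decays B F) :
    0 ≤ B := by
  have := (abs_nonneg _).trans (hF.bound 0)
  exact nonneg_of_mul_nonneg_left this (decay_pos 0)

lemma Decays.integrable {n : ℕ} {B : ℝ} {F : EuclideanSpace ℝ (Fin n) → ℝ} (hF : Decays B F) :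
    Integrable F :=
  (integrable_decay.const_mul B).mono' hF.cont.aestronglyMeasurable
    (Eventually.of_forall fun x => hF.bound x)

lemma Decays.measurable_shift {n : ℕ} {B : ℝ} {F : EuclideanSpace ℝ (Fin n) → ℝ}
    (hF : Decays B F) (x : EuclideanSpace ℝ (Fin n)) : Measurable fun y => F (x - y) :=
  (hF.cont.comp (by fun_prop : Continuous fun y => x - y)).measurable

lemma SingKernel.norm_mul_le {n s : ℕ} {A B : ℝ}
    {K F : EuclideanSpace ℝ (Fin n) → ℝ} (hK : SingKernel s A K) (hF : Decays B F)
    (x y : EuclideanSpace ℝ (Fin n)) (hy : y ≠ 0) :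
    ‖K y * F (x - y)‖ ≤ A * B * ((‖y‖ ^ s)⁻¹ * decay (x - y)) := by
  rw [norm_mul]
  calc _ ≤ (A * (‖y‖ ^ s)⁻¹) * (B * decay (x - y)) :=
        mul_le_mul (hK.bound y hy) (hF.bound _) (abs_nonneg _)
          (by have := hK.nonneg; positivity)
    _ = _ := by ring

lemma SingKernel.norm_mul_le_majorant {n s : ℕ} (hs : s + 1 ≤ n) {A B : ℝ}
    {K F : EuclideanSpace ℝ (Fin n) → ℝ} (hK : SingKernel s A K) (hF : Decays B F)
    (x y : EuclideanSpace ℝ (Fin n)) (hy : y ≠ 0) :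
    ‖K y * F (x - y)‖ ≤ A * B * ((1 + ‖x‖) ^ (n + 1) * singMajorant s y) :=
  (hK.norm_mul_le hF x y hy).trans (mul_le_mul_of_nonneg_left
    (inv_norm_pow_mul_decay_sub_le hs x y) (mul_nonneg hK.nonneg hF.nonneg))

lemma SingKernel.integrable_conv {n s : ℕ} (hs : s + 1 ≤ n) {A B : ℝ}
    {K F : EuclideanSpace ℝ (Fin n) → ℝ} (hK : SingKernel s A K) (hF : Decays B F)
    (x : EuclideanSpace ℝ (Fin n)) : Integrable fun y => K y * F (x - y) := by
  refine (((integrable_singMajorant hs).const_mul ((1 + ‖x‖) ^ (n + 1))).const_mul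
    (A * B)).mono' ?_ ?_
  · exact (hK.meas.mul (hF.measurable_shift x)).aestronglyMeasurable
  · filter_upwards [ae_ne_zero (by omega)] with y hy
    exact hK.norm_mul_le_majorant hs hF x y hy

lemma SingKernel.continuous_conv {n s : ℕ} (hs : s + 1 ≤ n) {A B : ℝ}
    {K F : EuclideanSpace ℝ (Fin n) → ℝ} (hK : SingKernel s A K) (hF : Decays B F) :
    Continuous (conv K F) := by
  rw [continuous_iff_continuousAt]
  intro x₀
  refine continuousAt_of_dominated (bound := fun y =>
    A * B * ((1 + (‖x₀‖ + 1)) ^ (n + 1) * singMajorant s y)) ?_ ?_ ?_ ?_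
  · exact Eventually.of_forall fun x =>
      (hK.meas.mul (hF.measurable_shift x)).aestronglyMeasurable
  · filter_upwards [Metric.ball_mem_nhds x₀ one_pos] with x hx
    have hx' : ‖x‖ ≤ ‖x₀‖ + 1 := by
      have := norm_le_norm_add_norm_sub' x x₀
      rw [mem_ball_iff_norm] at hx
      linarith
    filter_upwards [ae_ne_zero (by omega)] with y hy
    refine (hK.norm_mul_le_majorant hs hF x y hy).trans ?_
    have := hK.nonneg
    have := hF.nonneg
    have := singMajorant_nonneg s y
    gcongr
  · exact (((integrable_singMajorant hs).const_mul _).const_mul _)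
  · refine Eventually.of_forall fun y => ?_
    have := hF.cont
    exact Continuous.continuousAt (by fun_prop)

lemma SingKernel.weighted_conv_le {n s : ℕ} (hs : s + 1 ≤ n) {A B : ℝ}
    {K F : EuclideanSpace ℝ (Fin n) → ℝ} (hK : SingKernel s A K) (hF : Decays B F)
    (x : EuclideanSpace ℝ (Fin n)) :
    (1 + ‖x‖) ^ s * |conv K F x| ≤
      A * (3 ^ s * (∫ y : EuclideanSpace ℝ (Fin n), decay y) +
        2 ^ (n + 1) * ∫ y : EuclideanSpace ℝ (Fin n), singMajorant s y) * B := by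
  have i1 : Integrable fun y : EuclideanSpace ℝ (Fin n) => decay (x - y) :=
    (integrable_decay (n := n)).comp_sub_left x
  have e1 : ∫ y : EuclideanSpace ℝ (Fin n), decay (x - y) =
      ∫ y : EuclideanSpace ℝ (Fin n), decay y := integral_sub_left_eq_self _ _ _
  have hAB := mul_nonneg hK.nonneg hF.nonneg
  have key : (1 + ‖x‖) ^ s * |conv K F x| ≤ ∫ y : EuclideanSpace ℝ (Fin n), A * B *
      (3 ^ s * decay (x - y) + 2 ^ (n + 1) * singMajorant s y) := by
    have : (1 + ‖x‖) ^ s * |conv K F x| = ‖∫ y, (1 + ‖x‖) ^ s * (K y * F (x - y))‖ := by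
      rw [integral_const_mul, norm_mul, Real.norm_of_nonneg (by positivity)]; rfl
    rw [this]
    refine norm_integral_le_of_norm_le (((i1.const_mul _).add
      ((integrable_singMajorant hs).const_mul _)).const_mul _) ?_
    filter_upwards [ae_ne_zero (by omega)] with y hy
    rw [norm_mul, Real.norm_of_nonneg (by positivity)]
    calc _ ≤ (1 + ‖x‖) ^ s * (A * B * ((‖y‖ ^ s)⁻¹ * decay (x - y))) := by
          gcongr; exact hK.norm_mul_le hF x y hy
      _ = A * B * ((1 + ‖x‖) ^ s * ((‖y‖ ^ s)⁻¹ * decay (x - y))) := by ring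
      _ ≤ _ := by gcongr; exact weighted_singular_le hs x y hy
  refine key.trans (le_of_eq ?_)
  rw [integral_const_mul, integral_add (i1.const_mul _)
    ((integrable_singMajorant hs).const_mul _), integral_const_mul, integral_const_mul, e1]
  ring

lemma decays_decay_mul {n : ℕ} (φ : EuclideanSpace ℝ (Fin n) →ᵇ ℝ) :
    Decays ‖φ‖ (fun x => decay x * φ x) where
  cont := continuous_decay.mul φ.continuous
  bound x := by
    rw [abs_mul, abs_of_pos (decay_pos x), mul_comm]
    exact mul_le_mul_of_nonneg_right (φ.norm_coe_le_norm x) (decay_pos x).le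

/-- Convolution with a singular kernel, as a bounded operator between weighted spaces. -/
lemma SingKernel.exists_clm {n s : ℕ} (hs : s + 1 ≤ n) {A : ℝ}
    {K : EuclideanSpace ℝ (Fin n) → ℝ} (hK : SingKernel s A K) :
    ∃ T : (EuclideanSpace ℝ (Fin n) →ᵇ ℝ) →L[ℝ] (EuclideanSpace ℝ (Fin n) →ᵇ ℝ),
      ∀ φ x, T φ x = (1 + ‖x‖) ^ s * conv K (fun z => decay z * φ z) x := by
  set C := A * (3 ^ s * (∫ y : EuclideanSpace ℝ (Fin n), decay y) +
        2 ^ (n + 1) * ∫ y : EuclideanSpace ℝ (Fin n), singMajorant s y) with hC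
  have hb (φ : EuclideanSpace ℝ (Fin n) →ᵇ ℝ) (x) :
      ‖(1 + ‖x‖) ^ s * conv K (fun z => decay z * φ z) x‖ ≤ C * ‖φ‖ := by
    rw [norm_mul, Real.norm_of_nonneg (by positivity)]
    exact hK.weighted_conv_le hs (decays_decay_mul φ) x
  let T₀ : (EuclideanSpace ℝ (Fin n) →ᵇ ℝ) →ₗ[ℝ] (EuclideanSpace ℝ (Fin n) →ᵇ ℝ) :=
    { toFun := fun φ => BoundedContinuousFunction.ofNormedAddCommGroup
        (fun x => (1 + ‖x‖) ^ s * conv K (fun z => decay z * φ z) x)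
        ((by fun_prop : Continuous fun x : EuclideanSpace ℝ (Fin n) => (1 + ‖x‖) ^ s).mul
          (hK.continuous_conv hs (decays_decay_mul φ))) (C * ‖φ‖) (hb φ)
      map_add' := fun φ ψ => by
        ext x
        simp only [BoundedContinuousFunction.coe_ofNormedAddCommGroup,
          BoundedContinuousFunction.coe_add, Pi.add_apply]
        rw [← mul_add]
        congr 1
        unfold conv
        rw [← integral_add (hK.integrable_conv hs (decays_decay_mul φ) x)
          (hK.integrable_conv hs (decays_decay_mul ψ) x)]
        congr 1 with y
        ring
      map_smul' := fun c φ => by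
        ext x
        simp only [BoundedContinuousFunction.coe_ofNormedAddCommGroup,
          BoundedContinuousFunction.coe_smul, RingHom.id_apply, smul_eq_mul]
        rw [mul_left_comm]
        congr 1
        unfold conv
        rw [← integral_const_mul]
        congr 1 with y
        ring }
  refine ⟨T₀.mkContinuous C fun φ => ?_, fun φ x => rfl⟩
  refine (BoundedContinuousFunction.norm_le ((norm_nonneg _).trans (hb φ 0))).2 fun x => hb φ x

/-- The Kronecker symbol as a real number. -/
def kron {n : ℕ} (i j : Fin n) : ℝ := if i = j then 1 else 0

lemma sum_kron_mul {n : ℕ} (i : Fin n) (f : Fin n → ℝ) : ∑ k, kron k i * f k = f i := by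
  simp [kron]

lemma sum_kron_mul_right {n : ℕ} (i : Fin n) (f : Fin n → ℝ) : ∑ j, kron i j * f j = f i := by
  simp [kron]

/-- The regularised squared radius. -/
noncomputable def rad {n : ℕ} (e : ℝ) (x : EuclideanSpace ℝ (Fin n)) : ℝ := ‖x‖ ^ 2 + e

/-- The exponent for which `rad 0 ^ critExp n` is a multiple of the Newtonian kernel. -/
noncomputable def critExp (n : ℕ) : ℝ := 1 - n / 2

/-- Regularised (unnormalised) Oseen kernel of the Stokes system. -/
noncomputable def oseen {n : ℕ} (i j : Fin n) (e : ℝ) (x : EuclideanSpace ℝ (Fin n)) : ℝ :=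
  kron i j * (rad e x ^ critExp n - 2 * critExp n * e * rad e x ^ (critExp n - 1)) -
    2 * critExp n * x i * x j * rad e x ^ (critExp n - 1)

/-- The derivative of `oseen i j` in direction `k`. -/
noncomputable def oseenGrad {n : ℕ} (k i j : Fin n) (e : ℝ) (x : EuclideanSpace ℝ (Fin n)) : ℝ :=
  kron i j * (2 * critExp n * x k * rad e x ^ (critExp n - 1) -
      4 * critExp n * (critExp n - 1) * e * x k * rad e x ^ (critExp n - 2)) -
    2 * critExp n * (kron k i * x j + kron k j * x i) * rad e x ^ (critExp n - 1) -
    4 * critExp n * (critExp n - 1) * x i * x j * x k * rad e x ^ (critExp n - 2)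

/-- The derivative of `oseenGrad k i j` in direction `k`. -/
noncomputable def oseenHess {n : ℕ} (k i j : Fin n) (e : ℝ) (x : EuclideanSpace ℝ (Fin n)) : ℝ :=
  kron i j * (2 * critExp n * rad e x ^ (critExp n - 1) +
      4 * critExp n * (critExp n - 1) * x k * x k * rad e x ^ (critExp n - 2) -
      4 * critExp n * (critExp n - 1) * e * rad e x ^ (critExp n - 2) -
      8 * critExp n * (critExp n - 1) * (critExp n - 2) * e * x k * x k *
        rad e x ^ (critExp n - 3)) -
    4 * critExp n * kron k i * kron k j * rad e x ^ (critExp n - 1) -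
    4 * critExp n * (critExp n - 1) * (kron k i * x j + kron k j * x i) * x k *
      rad e x ^ (critExp n - 2) -
    4 * critExp n * (critExp n - 1) * (kron k i * x j * x k + kron k j * x i * x k + x i * x j) *
      rad e x ^ (critExp n - 2) -
    8 * critExp n * (critExp n - 1) * (critExp n - 2) * x i * x j * x k * x k *
      rad e x ^ (critExp n - 3)

/-- Regularised (unnormalised) pressure kernel of the Stokes system. -/
noncomputable def pressure {n : ℕ} (j : Fin n) (e : ℝ) (x : EuclideanSpace ℝ (Fin n)) : ℝ :=
  4 * critExp n * (critExp n - 1) * e * x j * rad e x ^ (critExp n - 2) -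
    4 * critExp n * x j * rad e x ^ (critExp n - 1)

/-- The derivative of `pressure j` in direction `i`. -/
noncomputable def pressureGrad {n : ℕ} (i j : Fin n) (e : ℝ)
    (x : EuclideanSpace ℝ (Fin n)) : ℝ :=
  4 * critExp n * (critExp n - 1) * e * (kron i j * rad e x ^ (critExp n - 2) +
      2 * (critExp n - 2) * x i * x j * rad e x ^ (critExp n - 3)) -
    4 * critExp n * kron i j * rad e x ^ (critExp n - 1) -
    8 * critExp n * (critExp n - 1) * x i * x j * rad e x ^ (critExp n - 2)

/-- Unnormalised approximate identity arising from the regularised Stokes kernels. -/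
noncomputable def bump (n : ℕ) (e : ℝ) (x : EuclideanSpace ℝ (Fin n)) : ℝ :=
  -8 * critExp n * (critExp n - 1) * (critExp n - 2) * e ^ 2 * rad e x ^ (critExp n - 3)

lemma rad_pos {n : ℕ} {e : ℝ} (he : 0 < e) (x : EuclideanSpace ℝ (Fin n)) : 0 < rad e x := by
  unfold rad; positivity

lemma rad_pos_of_ne {n : ℕ} {e : ℝ} (he : 0 ≤ e) {x : EuclideanSpace ℝ (Fin n)} (hx : x ≠ 0) :
    0 < rad e x := by
  have := norm_pos_iff.2 hx
  unfold rad; positivity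

lemma sum_sq_eq_rad_sub {n : ℕ} (e : ℝ) (x : EuclideanSpace ℝ (Fin n)) :
    ∑ k, x k * x k = rad e x - e := by
  rw [rad, EuclideanSpace.real_norm_sq_eq, add_sub_cancel_right]
  simp_rw [sq]

lemma rpow_crit_sub {r : ℝ} (hr : 0 < r) (c : ℝ) :
    r ^ (c - 1) = r ^ (c - 3) * r ^ 2 ∧ r ^ (c - 2) = r ^ (c - 3) * r := by
  constructor
  · rw [← Real.rpow_natCast, ← Real.rpow_add hr]; congr 1; push_cast; ring
  · conv_rhs => rw [← Real.rpow_one r]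
    rw [← Real.rpow_mul hr.le, ← Real.rpow_add hr]; congr 1; ring

lemma sum_quadratic {n : ℕ} (i j : Fin n) (e : ℝ) (x : EuclideanSpace ℝ (Fin n))
    (a b c d d' : ℝ) :
    ∑ k, (a + b * (x k * x k) + c * (kron k i * kron k j) + d * (kron k i * x k) +
      d' * (kron k j * x k)) =
      n * a + b * (rad e x - e) + c * kron i j + d * x i + d' * x j := by
  simp only [Finset.sum_add_distrib, ← Finset.mul_sum, sum_sq_eq_rad_sub e, sum_kron_mul]
  simp

lemma natCast_eq_critExp (n : ℕ) : (n : ℝ) = 2 - 2 * critExp n := by unfold critExp; ring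

lemma sum_oseenGrad {n : ℕ} (j : Fin n) {e : ℝ} {x : EuclideanSpace ℝ (Fin n)}
    (hr : 0 < rad e x) : ∑ i, oseenGrad i i j e x = 0 := by
  obtain ⟨h1, h2⟩ := rpow_crit_sub hr (critExp n)
  set b := critExp n with hb
  set R := rad e x ^ (b - 3)
  have key : ∀ k, oseenGrad k k j e x =
      (- 2 * b * x j * (R * rad e x ^ 2)) +
      (-4 * b * (b - 1) * x j * (R * rad e x)) * (x k * x k) + 0 * (kron k j * kron k j) +
      (2 * b * (R * rad e x ^ 2) - 4 * b * (b - 1) * e * (R * rad e x)) * (kron k j * x k) +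
      (- 2 * b * (R * rad e x ^ 2)) * (kron k j * x k) := by
    intro k
    have : kron k k = 1 := by simp [kron]
    rw [oseenGrad, ← hb, h1, h2, this]
    ring
  simp_rw [key]
  rw [sum_quadratic j j e, natCast_eq_critExp, ← hb]
  ring

lemma sum_oseenHess_sub {n : ℕ} (i j : Fin n) {e : ℝ} {x : EuclideanSpace ℝ (Fin n)}
    (hr : 0 < rad e x) :
    ∑ k, oseenHess k i j e x - pressureGrad i j e x = -(kron i j * bump n e x) := by
  obtain ⟨h1, h2⟩ := rpow_crit_sub hr (critExp n)
  set b := critExp n with hb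
  set R := rad e x ^ (b - 3) with hR
  have key : ∀ k, oseenHess k i j e x =
      (kron i j * (2 * b * (R * rad e x ^ 2) - 4 * b * (b - 1) * e * (R * rad e x)) -
        4 * b * (b - 1) * x i * x j * (R * rad e x)) +
      (kron i j * (4 * b * (b - 1) * (R * rad e x) - 8 * b * (b - 1) * (b - 2) * e * R) -
        8 * b * (b - 1) * (b - 2) * x i * x j * R) * (x k * x k) +
      (-4 * b * (R * rad e x ^ 2)) * (kron k i * kron k j) +
      (-8 * b * (b - 1) * x j * (R * rad e x)) * (kron k i * x k) +
      (-8 * b * (b - 1) * x i * (R * rad e x)) * (kron k j * x k) := by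
    intro k
    rw [oseenHess, ← hb, h1, h2, ← hR]
    ring
  simp_rw [key]
  rw [sum_quadratic i j e, natCast_eq_critExp, ← hb, pressureGrad, bump, ← hb, h1, h2, ← hR]
  ring

lemma hasLineDerivAt_coord {n : ℕ} (i k : Fin n) (x : EuclideanSpace ℝ (Fin n)) :
    HasDerivAt (fun t : ℝ => (x + t • EuclideanSpace.single k (1 : ℝ)) i) (kron k i) 0 := by
  have : HasDerivAt (fun t : ℝ => x i + t * kron k i) (1 * kron k i) 0 :=
    ((hasDerivAt_id (0 : ℝ)).mul_const _).const_add _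
  convert this using 1
  · ext t
    simp [kron, eq_comm]
  · simp

lemma hasLineDerivAt_rad_rpow {n : ℕ} (k : Fin n) {e : ℝ} (he : 0 < e) (c : ℝ)
    (x : EuclideanSpace ℝ (Fin n)) :
    HasDerivAt (fun t : ℝ => rad e (x + t • EuclideanSpace.single k (1 : ℝ)) ^ c)
      (2 * c * x k * rad e x ^ (c - 1)) 0 := by
  have h1 : HasDerivAt (fun t : ℝ => x + t • EuclideanSpace.single k (1 : ℝ))
      ((1 : ℝ) • EuclideanSpace.single k (1 : ℝ)) 0 :=
    ((hasDerivAt_id (0 : ℝ)).smul_const _).const_add _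
  have h2 := (h1.norm_sq.add_const e).rpow_const (p := c) (Or.inl (by positivity))
  refine h2.congr_deriv ?_
  rw [zero_smul, add_zero, one_smul, EuclideanSpace.inner_single_right, rad]
  simp only [conj_trivial, one_mul]
  ring

lemma hasLineDerivAt_oseen {n : ℕ} (k i j : Fin n) {e : ℝ} (he : 0 < e)
    (x : EuclideanSpace ℝ (Fin n)) :
    HasLineDerivAt ℝ (oseen i j e) (oseenGrad k i j e x) x (EuclideanSpace.single k 1) := by
  have hx := fun i => hasLineDerivAt_coord i k x
  have hp := fun c => hasLineDerivAt_rad_rpow k he c x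
  have e2 : critExp n - 1 - 1 = critExp n - 2 := by ring
  have h := (((hp (critExp n)).sub ((hp (critExp n - 1)).const_mul
    (2 * critExp n * e))).const_mul (kron i j)).sub
    ((((hx i).const_mul (2 * critExp n)).mul (hx j)).mul (hp (critExp n - 1)))
  refine HasDerivAt.congr_deriv (f := fun t => _) h ?_
  simp only [zero_smul, add_zero, oseenGrad, e2, Pi.mul_apply]
  ring

lemma hasLineDerivAt_oseenGrad {n : ℕ} (k i j : Fin n) {e : ℝ} (he : 0 < e)
    (x : EuclideanSpace ℝ (Fin n)) :
    HasLineDerivAt ℝ (oseenGrad k i j e) (oseenHess k i j e x) x (EuclideanSpace.single k 1) := by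
  have hx := fun i => hasLineDerivAt_coord i k x
  have hp := fun c => hasLineDerivAt_rad_rpow k he c x
  have e2 : critExp n - 1 - 1 = critExp n - 2 := by ring
  have e3 : critExp n - 2 - 1 = critExp n - 3 := by ring
  have h := ((((((hx k).const_mul (2 * critExp n)).mul (hp (critExp n - 1))).sub
    (((hx k).const_mul (4 * critExp n * (critExp n - 1) * e)).mul
      (hp (critExp n - 2)))).const_mul (kron i j)).sub
    (((((hx j).const_mul (kron k i)).add ((hx i).const_mul (kron k j))).const_mul
      (2 * critExp n)).mul (hp (critExp n - 1)))).sub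
    (((((hx i).const_mul (4 * critExp n * (critExp n - 1))).mul (hx j)).mul (hx k)).mul
      (hp (critExp n - 2)))
  refine HasDerivAt.congr_deriv (f := fun t => _) h ?_
  have : kron k k = 1 := by simp [kron]
  simp only [zero_smul, add_zero, oseenHess, e2, e3, Pi.mul_apply, Pi.add_apply, this]
  ring

lemma hasLineDerivAt_pressure {n : ℕ} (i j : Fin n) {e : ℝ} (he : 0 < e)
    (x : EuclideanSpace ℝ (Fin n)) :
    HasLineDerivAt ℝ (pressure j e) (pressureGrad i j e x) x (EuclideanSpace.single i 1) := by
  have hx := fun j => hasLineDerivAt_coord j i x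
  have hp := fun c => hasLineDerivAt_rad_rpow i he c x
  have e2 : critExp n - 1 - 1 = critExp n - 2 := by ring
  have e3 : critExp n - 2 - 1 = critExp n - 3 := by ring
  have h := (((hx j).const_mul (4 * critExp n * (critExp n - 1) * e)).mul
    (hp (critExp n - 2))).sub (((hx j).const_mul (4 * critExp n)).mul (hp (critExp n - 1)))
  refine HasDerivAt.congr_deriv (f := fun t => _) h ?_
  simp only [zero_smul, add_zero, pressureGrad, e2, e3]
  ring

/-- Functions of `(e, x)` bounded by a multiple of `rad e x ^ d`. -/
def RadBound {n : ℕ} (d : ℝ) (f : ℝ → EuclideanSpace ℝ (Fin n) → ℝ) : Prop :=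
  ∃ C, 0 ≤ C ∧ ∀ e, 0 ≤ e → ∀ x, 0 < rad e x → |f e x| ≤ C * rad e x ^ d

namespace RadBound

variable {n : ℕ} {d d' : ℝ} {f g : ℝ → EuclideanSpace ℝ (Fin n) → ℝ}

lemma exp_eq (hf : RadBound d f) (h : d = d') : RadBound d' f := h ▸ hf

lemma const (c : ℝ) : RadBound 0 (fun _ (_ : EuclideanSpace ℝ (Fin n)) => c) :=
  ⟨|c|, abs_nonneg c, fun e _ x _ => by simp⟩

lemma param : RadBound 1 (fun e (_ : EuclideanSpace ℝ (Fin n)) => e) :=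
  ⟨1, zero_le_one, fun e he x _ => by
    rw [abs_of_nonneg he, Real.rpow_one, rad]; nlinarith [sq_nonneg ‖x‖]⟩

lemma coord (i : Fin n) : RadBound (1 / 2) (fun _ (x : EuclideanSpace ℝ (Fin n)) => x i) :=
  ⟨1, zero_le_one, fun e he x _ => by
    rw [← Real.sqrt_eq_rpow, one_mul]
    refine Real.le_sqrt_of_sq_le ?_
    have h : |x i| ≤ ‖x‖ := by simpa using PiLp.norm_apply_le x i
    have := pow_le_pow_left₀ (abs_nonneg _) h 2
    unfold rad; linarith⟩

lemma rad_rpow (c : ℝ) : RadBound c (fun e (x : EuclideanSpace ℝ (Fin n)) => rad e x ^ c) :=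
  ⟨1, zero_le_one, fun e _ x hx => by rw [one_mul, abs_of_pos (by positivity)]⟩

lemma mul (hf : RadBound d f) (hg : RadBound d' g) :
    RadBound (d + d') (fun e x => f e x * g e x) := by
  obtain ⟨C, hC, hf⟩ := hf
  obtain ⟨C', hC', hg⟩ := hg
  refine ⟨C * C', by positivity, fun e he x hx => ?_⟩
  rw [abs_mul, Real.rpow_add hx, mul_mul_mul_comm]
  exact mul_le_mul (hf e he x hx) (hg e he x hx) (abs_nonneg _) (by positivity)

lemma add (hf : RadBound d f) (hg : RadBound d g) : RadBound d (fun e x => f e x + g e x) := by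
  obtain ⟨C, hC, hf⟩ := hf
  obtain ⟨C', hC', hg⟩ := hg
  refine ⟨C + C', by positivity, fun e he x hx => (abs_add_le _ _).trans ?_⟩
  rw [add_mul]
  exact add_le_add (hf e he x hx) (hg e he x hx)

lemma sub (hf : RadBound d f) (hg : RadBound d g) : RadBound d (fun e x => f e x - g e x) := by
  obtain ⟨C, hC, hf⟩ := hf
  obtain ⟨C', hC', hg⟩ := hg
  refine ⟨C + C', by positivity, fun e he x hx => (abs_sub _ _).trans ?_⟩
  rw [add_mul]
  exact add_le_add (hf e he x hx) (hg e he x hx)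

lemma const_mul (c : ℝ) (hf : RadBound d f) : RadBound d (fun e x => c * f e x) :=
  ((const c).mul hf).exp_eq (zero_add d)

lemma singKernel {m : ℕ} (hf : RadBound (-(m / 2 : ℝ)) f) (hm : ∀ e, Measurable (f e)) :
    ∃ A, ∀ e, 0 ≤ e → SingKernel m A (f e) := by
  obtain ⟨C, hC, hf⟩ := hf
  refine ⟨C, fun e he => ⟨hC, hm e, fun y hy => ?_⟩⟩
  have hr := rad_pos_of_ne he hy
  refine (hf e he y hr).trans (mul_le_mul_of_nonneg_left ?_ hC)
  have hy' := norm_pos_iff.2 hy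
  rw [Real.rpow_neg hr.le]
  refine inv_anti₀ (by positivity) ?_
  have h1 : ‖y‖ ^ m = (‖y‖ ^ 2) ^ (m / 2 : ℝ) := by
    rw [← Real.rpow_natCast, ← Real.rpow_natCast, ← Real.rpow_mul hy'.le]
    congr 1; push_cast; ring
  rw [h1]
  exact Real.rpow_le_rpow (by positivity) (by unfold rad; linarith) (by positivity)

lemma bounded (hf : RadBound d f) (hd : d ≤ 0) {e : ℝ} (he : 0 < e) : ∃ C, ∀ x, |f e x| ≤ C := by
  obtain ⟨C, hC, hf⟩ := hf
  refine ⟨C * e ^ d, fun x => (hf e he.le x (rad_pos he x)).trans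
    (mul_le_mul_of_nonneg_left ?_ hC)⟩
  exact Real.rpow_le_rpow_of_nonpos he (by unfold rad; nlinarith [sq_nonneg ‖x‖]) hd

end RadBound

lemma radBound_oseen {n : ℕ} (i j : Fin n) : RadBound (critExp n) (oseen i j) := by
  open RadBound in
  refine (const_mul _ (sub (rad_rpow _) ?_)).sub ?_
  · exact (((const _).mul param).mul (rad_rpow _)).exp_eq (by ring)
  · exact ((((const _).mul (coord i)).mul (coord j)).mul (rad_rpow _)).exp_eq (by ring)

lemma radBound_oseenGrad {n : ℕ} (k i j : Fin n) :
    RadBound (critExp n - 1 / 2) (oseenGrad k i j) := by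
  open RadBound in
  refine ((const_mul _ (sub ?_ ?_)).sub ?_).sub ?_
  · exact (((const _).mul (coord k)).mul (rad_rpow _)).exp_eq (by ring)
  · exact ((((const _).mul param).mul (coord k)).mul (rad_rpow _)).exp_eq (by ring)
  · exact (((const _).mul ((const_mul _ (coord j)).add (const_mul _ (coord i)))).mul
      (rad_rpow _)).exp_eq (by ring)
  · exact (((((const _).mul (coord i)).mul (coord j)).mul (coord k)).mul
      (rad_rpow _)).exp_eq (by ring)

lemma radBound_oseenHess {n : ℕ} (k i j : Fin n) :
    RadBound (critExp n - 1) (oseenHess k i j) := by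
  open RadBound in
  refine (((((const_mul _ (((add ?_ ?_).sub ?_).sub ?_)).sub ?_).sub ?_).sub ?_).sub ?_)
  · exact ((const _).mul (rad_rpow _)).exp_eq (by ring)
  · exact ((((const _).mul (coord k)).mul (coord k)).mul (rad_rpow _)).exp_eq (by ring)
  · exact (((const _).mul param).mul (rad_rpow _)).exp_eq (by ring)
  · exact (((((const _).mul param).mul (coord k)).mul (coord k)).mul
      (rad_rpow _)).exp_eq (by ring)
  · exact ((const _).mul (rad_rpow _)).exp_eq (by ring)
  · exact ((((const _).mul ((const_mul _ (coord j)).add (const_mul _ (coord i)))).mul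
      (coord k)).mul (rad_rpow _)).exp_eq (by ring)
  · exact (((const _).mul (((((const _).mul (coord j)).mul (coord k)).add
      (((const _).mul (coord i)).mul (coord k))).add
      (((coord i).mul (coord j)).exp_eq (by ring)))).mul (rad_rpow _)).exp_eq (by ring)
  · exact ((((((const _).mul (coord i)).mul (coord j)).mul (coord k)).mul (coord k)).mul
      (rad_rpow _)).exp_eq (by ring)

lemma radBound_pressure {n : ℕ} (j : Fin n) : RadBound (critExp n - 1 / 2) (pressure j) := by
  open RadBound in
  refine RadBound.sub ?_ ?_
  · exact ((((const _).mul param).mul (coord j)).mul (rad_rpow _)).exp_eq (by ring)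
  · exact (((const _).mul (coord j)).mul (rad_rpow _)).exp_eq (by ring)

lemma radBound_pressureGrad {n : ℕ} (i j : Fin n) :
    RadBound (critExp n - 1) (pressureGrad i j) := by
  open RadBound in
  refine (RadBound.sub ?_ ?_).sub ?_
  · exact (((const _).mul param).mul ((const_mul _ (rad_rpow (critExp n - 2))).add
      (((((const _).mul (coord i)).mul (coord j)).mul (rad_rpow _)).exp_eq (by ring)))).exp_eq
        (by ring)
  · exact ((const _).mul (rad_rpow _)).exp_eq (by ring)
  · exact ((((const _).mul (coord i)).mul (coord j)).mul (rad_rpow _)).exp_eq (by ring)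

lemma measurable_oseen {n : ℕ} (i j : Fin n) (e : ℝ) : Measurable (oseen i j e) := by
  unfold oseen rad; fun_prop

lemma measurable_oseenGrad {n : ℕ} (k i j : Fin n) (e : ℝ) : Measurable (oseenGrad k i j e) := by
  unfold oseenGrad rad; fun_prop

lemma measurable_oseenHess {n : ℕ} (k i j : Fin n) (e : ℝ) : Measurable (oseenHess k i j e) := by
  unfold oseenHess rad; fun_prop

lemma measurable_pressure {n : ℕ} (j : Fin n) (e : ℝ) : Measurable (pressure j e) := by
  unfold pressure rad; fun_prop

lemma measurable_pressureGrad {n : ℕ} (i j : Fin n) (e : ℝ) :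
    Measurable (pressureGrad i j e) := by
  unfold pressureGrad rad; fun_prop

lemma continuousAt_rad_rpow {n : ℕ} {x : EuclideanSpace ℝ (Fin n)} (hx : x ≠ 0) (c : ℝ) :
    ContinuousAt (fun e => rad e x ^ c) 0 :=
  ContinuousAt.rpow_const (by unfold rad; fun_prop) (Or.inl (rad_pos_of_ne le_rfl hx).ne')

lemma continuousAt_oseen {n : ℕ} (i j : Fin n) {x : EuclideanSpace ℝ (Fin n)} (hx : x ≠ 0) :
    ContinuousAt (fun e => oseen i j e x) 0 := by
  have := fun c => continuousAt_rad_rpow hx c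
  unfold oseen; fun_prop

lemma continuousAt_oseenGrad {n : ℕ} (k i j : Fin n) {x : EuclideanSpace ℝ (Fin n)}
    (hx : x ≠ 0) : ContinuousAt (fun e => oseenGrad k i j e x) 0 := by
  have := fun c => continuousAt_rad_rpow hx c
  unfold oseenGrad; fun_prop

lemma continuousAt_pressure {n : ℕ} (j : Fin n) {x : EuclideanSpace ℝ (Fin n)} (hx : x ≠ 0) :
    ContinuousAt (fun e => pressure j e x) 0 := by
  have := fun c => continuousAt_rad_rpow hx c
  unfold pressure; fun_prop

/-- The total mass of the approximate identity `bump`. -/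
noncomputable def bumpMass (n : ℕ) : ℝ := ∫ x : EuclideanSpace ℝ (Fin n), bump n 1 x

lemma bump_one_eq {n : ℕ} (x : EuclideanSpace ℝ (Fin n)) :
    bump n 1 x = (n * (n - 2) * (n + 2)) * (1 + ‖x‖ ^ 2) ^ (-((n : ℝ) + 4) / 2) := by
  have : critExp n - 3 = -((n : ℝ) + 4) / 2 := by unfold critExp; ring
  rw [bump, this, rad, add_comm (‖x‖ ^ 2)]
  unfold critExp
  ring

lemma bump_scale {n : ℕ} {c : ℝ} (hc : 0 < c) (x : EuclideanSpace ℝ (Fin n)) :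
    bump n (c ^ 2)⁻¹ x = c ^ n * bump n 1 (c • x) := by
  have h1 : rad (c ^ 2)⁻¹ x = (c ^ 2)⁻¹ * rad 1 (c • x) := by
    simp only [rad, norm_smul, mul_pow, Real.norm_eq_abs, sq_abs]
    field_simp
  have h2 : ((c ^ 2)⁻¹) ^ 2 * ((c ^ 2)⁻¹) ^ (critExp n - 3) = c ^ n := by
    rw [← Real.rpow_natCast, ← Real.rpow_natCast, ← Real.rpow_natCast, ← Real.rpow_neg hc.le,
      ← Real.rpow_mul hc.le, ← Real.rpow_mul hc.le, ← Real.rpow_add hc]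
    congr 1
    unfold critExp
    push_cast
    ring
  rw [bump, bump, h1, Real.mul_rpow (by positivity) (rad_pos one_pos _).le, ← h2]
  ring

lemma bump_one_nonneg {n : ℕ} (hn : 2 ≤ n) (x : EuclideanSpace ℝ (Fin n)) : 0 ≤ bump n 1 x := by
  have : (2 : ℝ) ≤ n := by exact_mod_cast hn
  rw [bump_one_eq]
  have : 0 ≤ (n : ℝ) - 2 := by linarith
  positivity

lemma integrable_bump_one (n : ℕ) : Integrable (bump n 1) := by
  have h := integrable_rpow_neg_one_add_norm_sq (E := EuclideanSpace ℝ (Fin n)) (μ := volume)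
    (r := (n : ℝ) + 4) (by simp)
  exact (h.const_mul ((n : ℝ) * (n - 2) * (n + 2))).congr
    (Eventually.of_forall fun x => (bump_one_eq x).symm)

lemma bumpMass_pos {n : ℕ} (hn : 3 ≤ n) : 0 < bumpMass n := by
  have h3 : (3 : ℝ) ≤ n := by exact_mod_cast hn
  have : 0 < (n : ℝ) - 2 := by linarith
  refine (integral_pos_iff_support_of_nonneg (bump_one_nonneg (by omega))
    (integrable_bump_one n)).2 ?_
  have : Function.support (bump n 1) = Set.univ := by
    ext x
    simp only [Function.mem_support, Set.mem_univ, iff_true, bump_one_eq]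
    positivity
  rw [this]
  exact Measure.measure_univ_pos.2 (NeZero.ne _)

lemma tendsto_norm_pow_mul_bump {n : ℕ} :
    Tendsto (fun x : EuclideanSpace ℝ (Fin n) => ‖x‖ ^ n * bump n 1 x)
      (Bornology.cobounded _) (𝓝 0) := by
  have h0 : Tendsto (fun x : EuclideanSpace ℝ (Fin n) =>
      |(n : ℝ) * (n - 2) * (n + 2)| * ‖x‖⁻¹) (Bornology.cobounded _) (𝓝 0) := by
    simpa using (tendsto_norm_cobounded_atTop.inv_tendsto_atTop).const_mul
      |(n : ℝ) * (n - 2) * (n + 2)|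
  refine squeeze_zero_norm' ?_ h0
  filter_upwards [tendsto_norm_cobounded_atTop.eventually (eventually_ge_atTop (1 : ℝ))] with x hx
  have hx0 : 0 < ‖x‖ := by linarith
  rw [bump_one_eq, norm_mul, norm_mul, norm_pow, norm_norm, mul_left_comm, Real.norm_eq_abs]
  gcongr
  rw [Real.norm_of_nonneg (by positivity)]
  have h1 : (1 + ‖x‖ ^ 2) ^ (-((n : ℝ) + 4) / 2) ≤ (‖x‖ ^ 2) ^ (-((n : ℝ) + 4) / 2) :=
    Real.rpow_le_rpow_of_nonpos (by positivity) (by linarith)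
      (by have : (0 : ℝ) ≤ n := n.cast_nonneg
          linarith)
  have h2 : (‖x‖ ^ 2) ^ (-((n : ℝ) + 4) / 2) = (‖x‖ ^ (n + 4))⁻¹ := by
    rw [← Real.rpow_natCast, ← Real.rpow_natCast, ← Real.rpow_mul hx0.le, ← Real.rpow_neg hx0.le]
    congr 1; push_cast; ring
  calc ‖x‖ ^ n * (1 + ‖x‖ ^ 2) ^ (-((n : ℝ) + 4) / 2) ≤ ‖x‖ ^ n * (‖x‖ ^ (n + 4))⁻¹ := by
        rw [← h2]; gcongr
    _ = (‖x‖ ^ 4)⁻¹ := by rw [pow_add]; field_simp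
    _ ≤ ‖x‖⁻¹ := inv_anti₀ hx0 (le_self_pow₀ hx (by norm_num))

lemma tendsto_conv_bump {n : ℕ} (hn : 3 ≤ n) {B : ℝ} {F : EuclideanSpace ℝ (Fin n) → ℝ}
    (hF : Decays B F) (x : EuclideanSpace ℝ (Fin n)) :
    Tendsto (fun c : ℝ => conv (bump n (c ^ 2)⁻¹) F x) atTop (𝓝 (bumpMass n * F x)) := by
  have hκ := bumpMass_pos hn
  have h := tendsto_integral_comp_smul_smul_of_integrable (μ := volume)
    (φ := fun y : EuclideanSpace ℝ (Fin n) => (bumpMass n)⁻¹ * bump n 1 y)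
    (g := fun y => F (x - y))
    (fun y => mul_nonneg (inv_nonneg.2 hκ.le) (bump_one_nonneg (by omega) y))
    (by rw [integral_const_mul]; exact inv_mul_cancel₀ hκ.ne')
    (by
      have := (tendsto_norm_pow_mul_bump (n := n)).const_mul (bumpMass n)⁻¹
      simp only [finrank_euclideanSpace, Fintype.card_fin]
      simpa only [mul_zero, mul_left_comm] using this)
    (hF.integrable.comp_sub_left x)
    (hF.cont.comp (by fun_prop : Continuous fun y => x - y)).continuousAt
  have h' := h.const_mul (bumpMass n)
  simp only [sub_zero] at h'
  refine h'.congr' ?_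
  filter_upwards [eventually_gt_atTop 0] with c hc
  rw [conv, ← integral_const_mul]
  congr 1 with y
  simp only [finrank_euclideanSpace, Fintype.card_fin, smul_eq_mul, bump_scale hc]
  field_simp

lemma tendsto_conv_kernel {n s : ℕ} (hs : s + 1 ≤ n) {A B : ℝ}
    {K : ℝ → EuclideanSpace ℝ (Fin n) → ℝ} {F : EuclideanSpace ℝ (Fin n) → ℝ}
    (hK : ∀ e, 0 ≤ e → SingKernel s A (K e))
    (hc : ∀ y, y ≠ 0 → ContinuousAt (fun e => K e y) 0) (hF : Decays B F)
    (x : EuclideanSpace ℝ (Fin n)) :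
    Tendsto (fun c : ℝ => conv (K (c ^ 2)⁻¹) F x) atTop (𝓝 (conv (K 0) F x)) := by
  have he : Tendsto (fun c : ℝ => (c ^ 2)⁻¹) atTop (𝓝 0) :=
    (tendsto_pow_atTop (by norm_num)).inv_tendsto_atTop
  have hK' := fun c : ℝ => hK (c ^ 2)⁻¹ (by positivity)
  refine tendsto_integral_filter_of_dominated_convergence
    (fun y => A * B * ((1 + ‖x‖) ^ (n + 1) * singMajorant s y)) ?_ ?_ ?_ ?_
  · exact Eventually.of_forall fun c =>
      ((hK' c).meas.mul (hF.measurable_shift x)).aestronglyMeasurable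
  · refine Eventually.of_forall fun c => ?_
    filter_upwards [ae_ne_zero (by omega)] with y hy
    exact (hK' c).norm_mul_le_majorant hs hF x y hy
  · exact ((integrable_singMajorant hs).const_mul _).const_mul _
  · filter_upwards [ae_ne_zero (by omega)] with y hy
    exact ((hc y hy).tendsto.comp he).mul_const _

lemma integrable_bounded_conv {n : ℕ} {B C : ℝ} {K F : EuclideanSpace ℝ (Fin n) → ℝ}
    (hm : Measurable K) (hb : ∀ y, |K y| ≤ C) (hF : Decays B F)
    (x : EuclideanSpace ℝ (Fin n)) : Integrable fun y => K y * F (x - y) :=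
  (hF.integrable.comp_sub_left x).bdd_mul hm.aestronglyMeasurable
    (Eventually.of_forall hb)

lemma conv_lineDeriv {n : ℕ} {B B' C C' : ℝ} {K K' F F' : EuclideanSpace ℝ (Fin n) → ℝ}
    {v : EuclideanSpace ℝ (Fin n)}
    (hKm : Measurable K) (hKb : ∀ y, |K y| ≤ C) (hKm' : Measurable K') (hKb' : ∀ y, |K' y| ≤ C')
    (hK : ∀ y, HasLineDerivAt ℝ K (K' y) y v) (hF : Decays B F) (hF' : Decays B' F')
    (hd : ∀ y, HasLineDerivAt ℝ F (F' y) y v) (x : EuclideanSpace ℝ (Fin n)) :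
    conv K F' x = conv K' F x := by
  have hg : ∀ y, HasLineDerivAt ℝ (fun y => F (x - y)) (-F' (x - y)) y v := by
    intro y
    have h1 : HasDerivAt (fun t : ℝ => F (x - y + t • v)) (F' (x - y)) (-0) := by
      rw [neg_zero]; exact hd (x - y)
    have h2 := h1.scomp (0 : ℝ) (hasDerivAt_neg (0 : ℝ))
    refine (h2.congr_deriv (by simp)).congr_of_eventuallyEq (Eventually.of_forall fun t => ?_)
    simp only [Function.comp_apply, neg_smul]
    congr 1
    abel
  have i1 := integrable_bounded_conv hKm' hKb' hF x
  have i2 := integrable_bounded_conv hKm hKb hF' x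
  have i3 := integrable_bounded_conv hKm hKb hF x
  have h := integral_bilinear_hasLineDerivAt_right_eq_neg_left_of_integrable
    (μ := volume) (f := K) (f' := K') (g := fun y => F (x - y)) (g' := fun y => -F' (x - y))
    (v := v) (B := ContinuousLinearMap.mul ℝ ℝ) (by simpa using i1) (by simpa using i2.neg)
    (by simpa using i3) (fun y _ => hK y) (fun y _ => hg y)
  simp only [ContinuousLinearMap.mul_apply', mul_neg, integral_neg, neg_inj] at h
  exact h

lemma critExp_eq {n : ℕ} (hn : 2 ≤ n) : critExp n = -(((n - 2 : ℕ) : ℝ) / 2) := by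
  rw [Nat.cast_sub hn]; unfold critExp; push_cast; ring

lemma critExp_sub_eq {n : ℕ} (hn : 2 ≤ n) :
    critExp n - 1 / 2 = -(((n - 1 : ℕ) : ℝ) / 2) := by
  rw [Nat.cast_sub (by omega)]; unfold critExp; push_cast; ring

lemma critExp_nonpos {n : ℕ} (hn : 2 ≤ n) : critExp n ≤ 0 := by
  rw [critExp_eq hn]; simp only [Left.neg_nonpos_iff]; positivity

lemma exists_singKernel_oseen {n : ℕ} (hn : 2 ≤ n) (i j : Fin n) :
    ∃ A, ∀ e, 0 ≤ e → SingKernel (n - 2) A (oseen i j e) :=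
  ((radBound_oseen i j).exp_eq (critExp_eq hn)).singKernel (measurable_oseen i j)

lemma exists_singKernel_oseenGrad {n : ℕ} (hn : 2 ≤ n) (k i j : Fin n) :
    ∃ A, ∀ e, 0 ≤ e → SingKernel (n - 1) A (oseenGrad k i j e) :=
  ((radBound_oseenGrad k i j).exp_eq (critExp_sub_eq hn)).singKernel (measurable_oseenGrad k i j)

lemma exists_singKernel_pressure {n : ℕ} (hn : 2 ≤ n) (j : Fin n) :
    ∃ A, ∀ e, 0 ≤ e → SingKernel (n - 1) A (pressure j e) :=
  ((radBound_pressure j).exp_eq (critExp_sub_eq hn)).singKernel (measurable_pressure j)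

lemma conv_oseen_deriv {n : ℕ} (hn : 2 ≤ n) {B B' : ℝ} {F F' : EuclideanSpace ℝ (Fin n) → ℝ}
    (k i j : Fin n) (hF : Decays B F) (hF' : Decays B' F')
    (hd : ∀ y, HasLineDerivAt ℝ F (F' y) y (EuclideanSpace.single k 1))
    (x : EuclideanSpace ℝ (Fin n)) :
    conv (oseen i j 0) F' x = conv (oseenGrad k i j 0) F x := by
  obtain ⟨A, hA⟩ := exists_singKernel_oseen hn i j
  obtain ⟨A', hA'⟩ := exists_singKernel_oseenGrad hn k i j
  have h1 := tendsto_conv_kernel (by omega) hA (fun y => continuousAt_oseen i j) hF' x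
  have h2 := tendsto_conv_kernel (by omega) hA' (fun y => continuousAt_oseenGrad k i j) hF x
  refine tendsto_nhds_unique (h1.congr' ?_) h2
  filter_upwards [eventually_gt_atTop 0] with c hc
  have he : 0 < (c ^ 2)⁻¹ := by positivity
  obtain ⟨C, hC⟩ := (radBound_oseen i j).bounded (critExp_nonpos hn) he
  obtain ⟨C', hC'⟩ := (radBound_oseenGrad k i j).bounded (by linarith [critExp_nonpos hn]) he
  exact conv_lineDeriv (measurable_oseen i j _) hC (measurable_oseenGrad k i j _) hC'
    (hasLineDerivAt_oseen k i j he) hF hF' hd x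

lemma sum_conv_oseenGrad {n : ℕ} (hn : 2 ≤ n) {B : ℝ} {F : EuclideanSpace ℝ (Fin n) → ℝ}
    (j : Fin n) (hF : Decays B F) (x : EuclideanSpace ℝ (Fin n)) :
    ∑ i, conv (oseenGrad i i j 0) F x = 0 := by
  unfold conv
  rw [← integral_finsetSum]
  · refine integral_eq_zero_of_ae ?_
    filter_upwards [ae_ne_zero (by omega)] with y hy
    rw [← Finset.sum_mul, sum_oseenGrad j (rad_pos_of_ne le_rfl hy), zero_mul]
    rfl
  · intro i _
    obtain ⟨A, hA⟩ := exists_singKernel_oseenGrad hn i i j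
    exact (hA 0 le_rfl).integrable_conv (by omega) hF x

lemma sum_conv_oseenGrad_deriv {n : ℕ} (hn : 3 ≤ n) {B : ℝ} {B' : Fin n → ℝ}
    {F : EuclideanSpace ℝ (Fin n) → ℝ} {F' : Fin n → EuclideanSpace ℝ (Fin n) → ℝ}
    (i j : Fin n) (hF : Decays B F) (hF' : ∀ k, Decays (B' k) (F' k))
    (hd : ∀ k y, HasLineDerivAt ℝ F (F' k y) y (EuclideanSpace.single k 1))
    (x : EuclideanSpace ℝ (Fin n)) :
    ∑ k, conv (oseenGrad k i j 0) (F' k) x - conv (pressure j 0) (F' i) x =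
      -(kron i j * (bumpMass n * F x)) := by
  have h1 : ∀ k, Tendsto (fun c : ℝ => conv (oseenGrad k i j (c ^ 2)⁻¹) (F' k) x) atTop
      (𝓝 (conv (oseenGrad k i j 0) (F' k) x)) := fun k => by
    obtain ⟨A, hA⟩ := exists_singKernel_oseenGrad (by omega) k i j
    exact tendsto_conv_kernel (by omega) hA (fun y => continuousAt_oseenGrad k i j) (hF' k) x
  have h2 : Tendsto (fun c : ℝ => conv (pressure j (c ^ 2)⁻¹) (F' i) x) atTop
      (𝓝 (conv (pressure j 0) (F' i) x)) := by
    obtain ⟨A, hA⟩ := exists_singKernel_pressure (by omega) j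
    exact tendsto_conv_kernel (by omega) hA (fun y => continuousAt_pressure j) (hF' i) x
  have h3 := ((tendsto_conv_bump hn hF x).const_mul (kron i j)).neg
  refine tendsto_nhds_unique (((tendsto_finsetSum _ fun k _ => h1 k).sub h2).congr' ?_) h3
  filter_upwards [eventually_gt_atTop 0] with c hc
  have he : 0 < (c ^ 2)⁻¹ := by positivity
  have hb := critExp_nonpos (show 2 ≤ n by omega)
  have e1 : ∀ k, ∃ C, ∀ x, |oseenHess k i j (c ^ 2)⁻¹ x| ≤ C := fun k =>
    (radBound_oseenHess k i j).bounded (by linarith) he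
  obtain ⟨C, hC⟩ := (radBound_pressureGrad i j).bounded (by linarith) he
  have e3 : ∀ k, conv (oseenGrad k i j (c ^ 2)⁻¹) (F' k) x =
      conv (oseenHess k i j (c ^ 2)⁻¹) F x := fun k => by
    obtain ⟨C₁, hC₁⟩ := e1 k
    obtain ⟨C₂, hC₂⟩ := (radBound_oseenGrad k i j).bounded (by linarith) he
    exact conv_lineDeriv (measurable_oseenGrad k i j _) hC₂ (measurable_oseenHess k i j _) hC₁
      (hasLineDerivAt_oseenGrad k i j he) hF (hF' k) (hd k) x
  have e4 : conv (pressure j (c ^ 2)⁻¹) (F' i) x = conv (pressureGrad i j (c ^ 2)⁻¹) F x := by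
    obtain ⟨C₂, hC₂⟩ := (radBound_pressure j).bounded (by linarith) he
    exact conv_lineDeriv (measurable_pressure j _) hC₂ (measurable_pressureGrad i j _) hC
      (hasLineDerivAt_pressure i j he) hF (hF' i) (hd i) x
  have i1 : ∀ k, Integrable fun y => oseenHess k i j (c ^ 2)⁻¹ y * F (x - y) := fun k => by
    obtain ⟨C₁, hC₁⟩ := e1 k
    exact integrable_bounded_conv (measurable_oseenHess k i j _) hC₁ hF x
  have i2 := integrable_bounded_conv (measurable_pressureGrad i j (c ^ 2)⁻¹) hC hF x
  simp_rw [e3]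
  rw [e4]
  unfold conv
  rw [← integral_finsetSum _ fun k _ => i1 k, ← integral_sub
    (integrable_finsetSum _ fun k _ => i1 k) i2, ← integral_const_mul, ← integral_neg]
  congr 1 with y
  rw [← Finset.sum_mul, ← sub_mul, sum_oseenHess_sub i j (rad_pos he y)]
  ring

lemma exists_translate {E : Type*} [NormedAddCommGroup E] {g : E → ℝ}
    (hg : Continuous g) (hc : HasCompactSupport g) :
    ∃ τ : E → (E →ᵇ ℝ), ∀ h x, τ h x = g (x + h) := by
  obtain ⟨C, hC⟩ := hg.bounded_above_of_compact_support hc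
  exact ⟨fun h => BoundedContinuousFunction.ofNormedAddCommGroup (fun x => g (x + h))
    (by fun_prop) C fun x => hC _, fun h x => rfl⟩

lemma hasFDerivAt_translate {E : Type*} [NormedAddCommGroup E] [NormedSpace ℝ E] {g : E → ℝ}
    (hg : ContDiff ℝ 1 g) (hc : HasCompactSupport g)
    {τ : E → (E →ᵇ ℝ)} (hτ : ∀ h x, τ h x = g (x + h)) (h : E)
    {L : E →L[ℝ] (E →ᵇ ℝ)} (hL : ∀ v x, L v x = fderiv ℝ g (x + h) v) :
    HasFDerivAt τ L h := by
  have huc : UniformContinuous (fderiv ℝ g) :=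
    (hg.continuous_fderiv one_ne_zero).uniformContinuous_of_tendsto_cocompact
      (x := 0) ((hc.fderiv (𝕜 := ℝ)).is_zero_at_infty)
  rw [hasFDerivAt_iff_isLittleO_nhds_zero, Asymptotics.isLittleO_iff]
  intro ε hε
  obtain ⟨δ, hδ, hd⟩ := Metric.uniformContinuous_iff.1 huc ε hε
  filter_upwards [Metric.ball_mem_nhds (0 : E) hδ] with v hv
  refine (BoundedContinuousFunction.norm_le (by positivity)).2 fun x => ?_
  simp only [BoundedContinuousFunction.coe_sub, Pi.sub_apply, hτ, hL]
  have := (convex_ball (x + h) δ).norm_image_sub_le_of_norm_fderiv_le' (𝕜 := ℝ) (f := g) (C := ε)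
    (φ := fderiv ℝ g (x + h)) (x := x + h) (y := x + (h + v))
    (fun y _ => (hg.differentiable one_ne_zero) y)
    (fun y hy => by rw [← dist_eq_norm]; exact (hd hy).le) (Metric.mem_ball_self hδ)
    (by rw [Metric.mem_ball, dist_eq_norm]; simpa [← add_assoc] using hv)
  simpa [← add_assoc] using this

lemma contDiff_translate {E : Type*} [NormedAddCommGroup E] [NormedSpace ℝ E]
    [FiniteDimensional ℝ E] {g : E → ℝ}
    (hg : ContDiff ℝ (⊤ : ℕ∞) g) (hc : HasCompactSupport g)
    {τ : E → (E →ᵇ ℝ)} (hτ : ∀ h x, τ h x = g (x + h)) : ContDiff ℝ (⊤ : ℕ∞) τ := by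
  rw [contDiff_infty]
  intro k
  have key (g : E → ℝ) (hg : ContDiff ℝ (⊤ : ℕ∞) g) (hc : HasCompactSupport g)
      (τ : E → (E →ᵇ ℝ)) (hτ : ∀ h x, τ h x = g (x + h)) :
      ∃ L : E → E →L[ℝ] (E →ᵇ ℝ), (∀ h v x, L h v x = fderiv ℝ g (x + h) v) ∧
        ∀ h, HasFDerivAt τ (L h) h := by
    have hgv (v : E) : ContDiff ℝ (⊤ : ℕ∞) (fun x => fderiv ℝ g x v) :=
      (hg.fderiv_right (m := (⊤ : ℕ∞)) le_rfl).clm_apply contDiff_const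
    choose σ hσ using fun v => exists_translate (hgv v).continuous (hc.fderiv_apply ℝ v)
    let L (h : E) : E →ₗ[ℝ] (E →ᵇ ℝ) :=
      { toFun := fun v => σ v h
        map_add' := fun v w => by ext x; simp [hσ]
        map_smul' := fun c v => by ext x; simp [hσ] }
    have hL (h v x) : LinearMap.toContinuousLinearMap (L h) v x = fderiv ℝ g (x + h) v := hσ v h x
    exact ⟨fun h => LinearMap.toContinuousLinearMap (L h), hL, fun h =>
      hasFDerivAt_translate (hg.of_le (by simp)) hc hτ h (hL h)⟩
  induction k generalizing g τ with
  | zero =>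
    obtain ⟨L, -, hL⟩ := key g hg hc τ hτ
    exact contDiff_zero.2 (continuous_iff_continuousAt.2 fun h => (hL h).continuousAt)
  | succ k ih =>
    obtain ⟨L, hL, hd⟩ := key g hg hc τ hτ
    have : ((k + 1 : ℕ) : WithTop ℕ∞) = (k : WithTop ℕ∞) + 1 := by push_cast; rfl
    rw [this, contDiff_succ_iff_fderiv_apply]
    refine ⟨fun h => (hd h).differentiableAt, by simp, fun v => ?_⟩
    refine ih ((hg.fderiv_right (m := (⊤ : ℕ∞)) le_rfl).clm_apply contDiff_const)
      (hc.fderiv_apply ℝ v) fun h x => ?_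
    rw [(hd h).fderiv, hL]

open scoped ContDiff in
lemma exists_local_solution_operator {X : Type*} [NormedAddCommGroup X] [NormedSpace ℝ X]
    [CompleteSpace X] {Q : X → X} (hQ : ContDiff ℝ ω Q) (hQ0 : Q 0 = 0)
    (hQ' : HasFDerivAt Q (0 : X →L[ℝ] X) 0) :
    ∃ (S : X → X) (ρ : ℝ), 0 < ρ ∧ (∀ ψ, ‖ψ‖ < ρ → S (ψ + Q ψ) = ψ) ∧
      ∀ r : ℝ, 0 < r → ∃ δ : ℝ, 0 < δ ∧ ∀ g, ‖g‖ < δ →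
        S g + Q (S g) = g ∧ ‖S g‖ < r ∧ ContDiffAt ℝ (⊤ : ℕ∞) S g := by
  set Φ : X → X := fun ψ => ψ + Q ψ with hΦ
  have hc : ContDiffAt ℝ ω Φ 0 := (contDiff_id.add hQ).contDiffAt
  have h0 : Φ 0 = 0 := by simp [hΦ, hQ0]
  have hd : HasFDerivAt Φ ((ContinuousLinearEquiv.refl ℝ X : X ≃L[ℝ] X) : X →L[ℝ] X) 0 := by
    have := (hasFDerivAt_id (𝕜 := ℝ) (0 : X)).add hQ'
    rw [add_zero] at this
    exact this
  have hω : (ω : WithTop ℕ∞) ≠ 0 := by simp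
  set S := hc.localInverse hd hω with hS
  have hS0 : S 0 = 0 := by have := hc.localInverse_apply_image hd hω; rwa [h0] at this
  have hSc : ContDiffAt ℝ ω S 0 := by have := hc.to_localInverse hd hω; rwa [h0] at this
  have hstr := hc.hasStrictFDerivAt' hd hω
  have hl : ∀ᶠ ψ in 𝓝 0, S (Φ ψ) = ψ := hstr.eventually_left_inverse
  have hr : ∀ᶠ g in 𝓝 0, Φ (S g) = g := by
    have := hstr.eventually_right_inverse; rwa [h0] at this
  obtain ⟨ρ, hρ, hρ'⟩ := Metric.eventually_nhds_iff.1 hl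
  refine ⟨S, ρ, hρ, fun ψ hψ => hρ' (by simpa using hψ), fun r hr0 => ?_⟩
  have hsm : ∀ᶠ g in 𝓝 0, ‖S g‖ < r := by
    have h1 : Tendsto (fun g => ‖S g‖) (𝓝 0) (𝓝 0) := by
      have := hSc.continuousAt.norm.tendsto
      rwa [hS0, norm_zero] at this
    exact h1.eventually (gt_mem_nhds hr0)
  obtain ⟨δ, hδ, hδ'⟩ := Metric.eventually_nhds_iff.1 (hr.and (hsm.and (hSc.eventually (by simp))))
  refine ⟨δ, hδ, fun g hg => ?_⟩
  obtain ⟨h1, h2, h3⟩ := hδ' (show dist g 0 < δ by simpa using hg)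
  exact ⟨h1, h2, h3.of_le le_top⟩

lemma one_add_norm_le_two_mul {n : ℕ} {x h : EuclideanSpace ℝ (Fin n)} (hh : ‖h‖ ≤ 1) :
    1 + ‖x‖ ≤ 2 * (1 + ‖x + h‖) := by
  have : ‖x‖ ≤ ‖x + h‖ + ‖h‖ := by simpa using norm_sub_le (x + h) h
  linarith [norm_nonneg (x + h)]

lemma decay_add_le {n : ℕ} {x h : EuclideanSpace ℝ (Fin n)} (hh : ‖h‖ ≤ 1) :
    decay (x + h) ≤ 2 ^ (n + 1) * decay x := by
  unfold decay
  rw [← div_eq_mul_inv, inv_eq_one_div, div_le_div_iff₀ (by positivity) (by positivity), one_mul,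
    ← mul_pow]
  exact pow_le_pow_left₀ (by positivity) (one_add_norm_le_two_mul hh) _

/-- Translates of a test function, in the weighted space. -/
lemma exists_weighted_translate {n : ℕ} {g : EuclideanSpace ℝ (Fin n) → ℝ} {ε : ℝ}
    (hg : ContDiff ℝ (⊤ : ℕ∞) g)
    (hsupp : Function.support g ⊆ Metric.ball (0 : EuclideanSpace ℝ (Fin n)) 3)
    (hb : ∀ x, |g x| ≤ ε) :
    ∃ τ : EuclideanSpace ℝ (Fin n) → (EuclideanSpace ℝ (Fin n) →ᵇ ℝ),
      ContDiff ℝ (⊤ : ℕ∞) τ ∧ (∀ h, ‖τ h‖ ≤ 5 ^ (n + 1) * ε) ∧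
      ∀ h, ‖h‖ ≤ 1 → ∀ x, decay x * τ h x = g (x + h) := by
  have hε : 0 ≤ ε := (abs_nonneg _).trans (hb 0)
  have hc : HasCompactSupport g := HasCompactSupport.intro (isCompact_closedBall 0 3) fun x hx => by
    by_contra hne
    exact hx (Metric.ball_subset_closedBall (hsupp hne))
  obtain ⟨σ, hσ⟩ := exists_translate hg.continuous hc
  let m : EuclideanSpace ℝ (Fin n) →ᵇ ℝ := BoundedContinuousFunction.ofNormedAddCommGroup
    (fun x => min ((1 + ‖x‖) ^ (n + 1)) (5 ^ (n + 1))) (by fun_prop) (5 ^ (n + 1)) fun x => by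
      rw [Real.norm_of_nonneg (by positivity)]; exact min_le_right _ _
  have hm (x) : m x = min ((1 + ‖x‖) ^ (n + 1)) (5 ^ (n + 1)) := rfl
  refine ⟨fun h => m * σ h, contDiff_const.mul (contDiff_translate hg hc hσ), fun h => ?_,
    fun h hh x => ?_⟩
  · refine (BoundedContinuousFunction.norm_le (by positivity)).2 fun x => ?_
    rw [BoundedContinuousFunction.mul_apply, hσ, norm_mul, hm, Real.norm_of_nonneg (by positivity)]
    exact mul_le_mul (min_le_right _ _) (hb _) (abs_nonneg _) (by positivity)
  · rw [BoundedContinuousFunction.mul_apply, hσ, hm]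
    by_cases hx : g (x + h) = 0
    · simp [hx]
    have h3 : ‖x + h‖ < 3 := by simpa using hsupp hx
    have h4 : ‖x‖ ≤ ‖x + h‖ + ‖h‖ := by simpa using norm_sub_le (x + h) h
    rw [min_eq_left (pow_le_pow_left₀ (by positivity) (by linarith) _), ← mul_assoc, decay,
      inv_mul_cancel₀ (by positivity), one_mul]

lemma conv_translate {n : ℕ} (K F : EuclideanSpace ℝ (Fin n) → ℝ) (x h : EuclideanSpace ℝ (Fin n)) :
    conv K (fun z => F (z + h)) x = conv K F (x + h) := by
  unfold conv
  congr 1 with y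
  change K y * F (x - y + h) = _
  rw [sub_add_eq_add_sub]

lemma exists_weighted_shift {n : ℕ} (φ : EuclideanSpace ℝ (Fin n) →ᵇ ℝ)
    {h : EuclideanSpace ℝ (Fin n)} (hh : ‖h‖ ≤ 1) :
    ∃ ψ : EuclideanSpace ℝ (Fin n) →ᵇ ℝ, ‖ψ‖ ≤ 2 ^ (n + 1) * ‖φ‖ ∧
      ∀ x, decay x * ψ x = decay (x + h) * φ (x + h) := by
  have hb (x) : ‖(decay x)⁻¹ * (decay (x + h) * φ (x + h))‖ ≤ 2 ^ (n + 1) * ‖φ‖ := by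
    rw [← mul_assoc, norm_mul, Real.norm_of_nonneg
      (mul_nonneg (inv_nonneg.2 (decay_pos _).le) (decay_pos _).le)]
    refine mul_le_mul ?_ (φ.norm_coe_le_norm _) (norm_nonneg _) (by positivity)
    rw [inv_mul_le_iff₀ (decay_pos x), mul_comm]
    exact decay_add_le hh
  refine ⟨BoundedContinuousFunction.ofNormedAddCommGroup
    (fun x => (decay x)⁻¹ * (decay (x + h) * φ (x + h))) ?_ _ hb,
    BoundedContinuousFunction.norm_ofNormedAddCommGroup_le _ (by positivity) hb, fun x => ?_⟩
  · exact (continuous_decay.inv₀ fun x => (decay_pos x).ne').mul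
      ((continuous_decay.comp (by fun_prop)).mul (φ.continuous.comp (by fun_prop)))
  · exact mul_inv_cancel_left₀ (decay_pos x).ne' _

open scoped ContDiff in
/-- The convection term as an analytic quadratic map on the weighted space. -/
lemma exists_quadratic {n : ℕ} (hn : 4 ≤ n) (c : ℝ)
    {K : Fin n → Fin n → EuclideanSpace ℝ (Fin n) → ℝ}
    {G : Fin n → Fin n → Fin n → EuclideanSpace ℝ (Fin n) → ℝ}
    (hK : ∀ i j, ∃ A, SingKernel (n - 2) A (K i j))
    (hG : ∀ i k l, ∃ A, SingKernel (n - 1) A (G i k l)) :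
    ∃ Q : (Fin n → EuclideanSpace ℝ (Fin n) →ᵇ ℝ) → (Fin n → EuclideanSpace ℝ (Fin n) →ᵇ ℝ),
      ContDiff ℝ ω Q ∧ Q 0 = 0 ∧
      HasFDerivAt Q (0 : (Fin n → EuclideanSpace ℝ (Fin n) →ᵇ ℝ) →L[ℝ]
        (Fin n → EuclideanSpace ℝ (Fin n) →ᵇ ℝ)) 0 ∧
      ∀ φ k x, decay x * Q φ k x = c * ∑ i, (∑ j, conv (K i j) (fun z => decay z * φ j z) x) *
        ∑ l, conv (G i k l) (fun z => decay z * φ l z) x := by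
  have h1 (i j) : ∃ T : (EuclideanSpace ℝ (Fin n) →ᵇ ℝ) →L[ℝ] (EuclideanSpace ℝ (Fin n) →ᵇ ℝ),
      ∀ φ x, T φ x = (1 + ‖x‖) ^ (n - 2) * conv (K i j) (fun z => decay z * φ z) x := by
    obtain ⟨A, hA⟩ := hK i j
    exact hA.exists_clm (by omega)
  have h2 (i k l) : ∃ T : (EuclideanSpace ℝ (Fin n) →ᵇ ℝ) →L[ℝ] (EuclideanSpace ℝ (Fin n) →ᵇ ℝ),
      ∀ φ x, T φ x = (1 + ‖x‖) ^ (n - 1) * conv (G i k l) (fun z => decay z * φ z) x := by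
    obtain ⟨A, hA⟩ := hG i k l
    exact hA.exists_clm (by omega)
  choose T hT using h1
  choose U hU using h2
  let m : EuclideanSpace ℝ (Fin n) →ᵇ ℝ := BoundedContinuousFunction.ofNormedAddCommGroup
    (fun x => c * ((1 + ‖x‖) ^ (n - 4))⁻¹)
    (continuous_const.mul (Continuous.inv₀ (by fun_prop) fun x => by positivity)) |c| fun x => by
      rw [norm_mul, Real.norm_of_nonneg (by positivity : (0 : ℝ) ≤ ((1 + ‖x‖) ^ (n - 4))⁻¹)]
      exact mul_le_of_le_one_right (abs_nonneg _)
        (inv_le_one_of_one_le₀ (one_le_pow₀ (by linarith [norm_nonneg x])))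
  have hm (x) : m x = c * ((1 + ‖x‖) ^ (n - 4))⁻¹ := rfl
  let a (i : Fin n) : (Fin n → EuclideanSpace ℝ (Fin n) →ᵇ ℝ) →L[ℝ] (EuclideanSpace ℝ (Fin n) →ᵇ ℝ) :=
    ∑ j, (T i j).comp (ContinuousLinearMap.proj j)
  let b (i k : Fin n) : (Fin n → EuclideanSpace ℝ (Fin n) →ᵇ ℝ) →L[ℝ] (EuclideanSpace ℝ (Fin n) →ᵇ ℝ) :=
    ∑ l, (U i k l).comp (ContinuousLinearMap.proj l)
  have ha (i) (φ : Fin n → EuclideanSpace ℝ (Fin n) →ᵇ ℝ) (x) : a i φ x = ∑ j, T i j (φ j) x := by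
    simp [a, BoundedContinuousFunction.coe_sum]
  have hb (i k) (φ : Fin n → EuclideanSpace ℝ (Fin n) →ᵇ ℝ) (x) : b i k φ x = ∑ l, U i k l (φ l) x := by
    simp [b, BoundedContinuousFunction.coe_sum]
  refine ⟨fun φ k => m * ∑ i, a i φ * b i k φ, ?_, ?_, ?_, fun φ k x => ?_⟩
  · exact contDiff_pi.2 fun k => contDiff_const.mul
      (ContDiff.sum fun i _ => (a i).contDiff.mul (b i k).contDiff)
  · ext k; simp
  · refine hasFDerivAt_pi'.2 fun k => ?_
    have hi (i) : HasFDerivAt (fun φ : Fin n → EuclideanSpace ℝ (Fin n) →ᵇ ℝ => a i φ * b i k φ) (0 : (Fin n → EuclideanSpace ℝ (Fin n) →ᵇ ℝ) →L[ℝ] _) 0 := by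
      have := (a i).hasFDerivAt (x := 0) |>.fun_mul ((b i k).hasFDerivAt (x := 0))
      refine this.congr_fderiv ?_
      ext φ x
      simp
    have := (HasFDerivAt.fun_sum fun i (_ : i ∈ Finset.univ) => hi i).const_mul m
    simpa using this
  · rw [BoundedContinuousFunction.mul_apply, BoundedContinuousFunction.sum_apply, hm]
    simp only [BoundedContinuousFunction.mul_apply, ha, hb, hT, hU, ← Finset.mul_sum]
    rw [Finset.mul_sum, Finset.mul_sum, Finset.mul_sum]
    refine Finset.sum_congr rfl fun i _ => ?_
    have hp : (1 + ‖x‖) ^ (n + 1) = (1 + ‖x‖) ^ (n - 4) * (1 + ‖x‖) ^ (4 + 1) := by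
      rw [← pow_add]; congr 1; omega
    have hq : (1 + ‖x‖) ^ (n - 2) = (1 + ‖x‖) ^ (n - 4) * (1 + ‖x‖) ^ 2 := by
      rw [← pow_add]; congr 1; omega
    have hr : (1 + ‖x‖) ^ (n - 1) = (1 + ‖x‖) ^ (n - 4) * (1 + ‖x‖) ^ 3 := by
      rw [← pow_add]; congr 1; omega
    rw [decay, hp, hq, hr]
    have : 1 + ‖x‖ ≠ 0 := by positivity
    field_simp

/-- For small data the convection equation is solvable in the weighted space, and the translates
of the solution depend smoothly on the translation. -/
lemma exists_smooth_translates {n : ℕ} (hn : 4 ≤ n) (c : ℝ)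
    {K : Fin n → Fin n → EuclideanSpace ℝ (Fin n) → ℝ}
    {G : Fin n → Fin n → Fin n → EuclideanSpace ℝ (Fin n) → ℝ}
    (hK : ∀ i j, ∃ A, SingKernel (n - 2) A (K i j))
    (hG : ∀ i k l, ∃ A, SingKernel (n - 1) A (G i k l)) :
    ∃ ε : ℝ, 0 < ε ∧ ∀ f : Fin n → EuclideanSpace ℝ (Fin n) → ℝ,
      (∀ j, ContDiff ℝ (⊤ : ℕ∞) (f j)) →
      (∀ j, Function.support (f j) ⊆ Metric.ball (0 : EuclideanSpace ℝ (Fin n)) 3) →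
      (∀ j x, |f j x| ≤ ε) →
      ∃ (φ : Fin n → EuclideanSpace ℝ (Fin n) →ᵇ ℝ)
        (σ : Fin n → EuclideanSpace ℝ (Fin n) → EuclideanSpace ℝ (Fin n) →ᵇ ℝ),
        (∀ j, ‖φ j‖ ≤ 1) ∧ (∀ j, ContDiffAt ℝ (⊤ : ℕ∞) (σ j) 0) ∧
        (∀ j, ∀ᶠ h in 𝓝 0, ∀ x, decay x * σ j h x = decay (x + h) * φ j (x + h)) ∧
        ∀ k x, decay x * φ k x +
          c * ∑ i, (∑ j, conv (K i j) (fun z => decay z * φ j z) x) *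
            ∑ l, conv (G i k l) (fun z => decay z * φ l z) x = f k x := by
  obtain ⟨Q, hQ, hQ0, hQd, hQe⟩ := exists_quadratic hn c hK hG
  obtain ⟨S, ρ, hρ, hSl, hS⟩ := exists_local_solution_operator hQ hQ0 hQd
  obtain ⟨δ, hδ, hSδ⟩ := hS (min 1 (ρ / 2 ^ (n + 1))) (by positivity)
  refine ⟨δ / (2 * 5 ^ (n + 1)), by positivity, fun f hf hsupp hfb => ?_⟩
  choose τ hτ hτb hτe using fun j => exists_weighted_translate (hf j) (hsupp j) (hfb j)
  have hτδ (h) : ‖fun j => τ j h‖ < δ := by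
    refine (pi_norm_lt_iff hδ).2 fun j => (hτb j h).trans_lt ?_
    field_simp
    norm_num
  set φ := S (fun j => τ j 0) with hφ
  obtain ⟨hφe, hφn, hSc⟩ := hSδ _ (hτδ 0)
  rw [← hφ] at hφe hφn
  have hφk (k) (x) : decay x * φ k x +
      c * ∑ i, (∑ j, conv (K i j) (fun z => decay z * φ j z) x) *
        ∑ l, conv (G i k l) (fun z => decay z * φ l z) x = f k x := by
    rw [← hQe, ← mul_add, ← add_zero x, ← hτe k 0 (by simp), add_zero, ← congrFun hφe k]
    rfl
  have hσ : ContDiffAt ℝ (⊤ : ℕ∞) (fun h => S (fun j => τ j h)) 0 :=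
    ContDiffAt.comp (g := S) (0 : EuclideanSpace ℝ (Fin n)) hSc
      (contDiff_pi.2 hτ).contDiffAt
  refine ⟨φ, fun j h => S (fun j => τ j h) j, fun j => (norm_le_pi_norm φ j).trans
    (hφn.le.trans (min_le_left _ _)), fun j => contDiffAt_pi.1 hσ j, fun j => ?_, hφk⟩
  filter_upwards [Metric.ball_mem_nhds (0 : EuclideanSpace ℝ (Fin n)) one_pos] with h hh
  have hh : ‖h‖ ≤ 1 := by simpa using (mem_ball_zero_iff.1 hh).le
  choose ψ hψn hψe using fun j => exists_weighted_shift (φ j) hh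
  have hψρ : ‖ψ‖ < ρ := by
    refine (pi_norm_lt_iff hρ).2 fun j => (hψn j).trans_lt ?_
    have := (norm_le_pi_norm φ j).trans_lt (hφn.trans_le (min_le_right _ _))
    rwa [lt_div_iff₀' (by positivity)] at this
  have hψτ : ψ + Q ψ = fun j => τ j h := by
    ext k x
    refine mul_left_cancel₀ (decay_pos x).ne' ?_
    rw [hτe k h hh, ← hφk, Pi.add_apply, BoundedContinuousFunction.add_apply, mul_add, hQe]
    have ht (L) (j) : conv L (fun z => decay (z + h) * φ j (z + h)) x =
        conv L (fun z => decay z * φ j z) (x + h) := conv_translate L (fun z => decay z * φ j z) x h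
    simp only [hψe, ht]
  intro x
  rw [← hψτ, hSl ψ hψρ, hψe]

lemma contDiffAt_of_translate {E V : Type*} [NormedAddCommGroup E] [NormedSpace ℝ E]
    [NormedAddCommGroup V] [NormedSpace ℝ V] {σ : E → V} (hσ : ContDiffAt ℝ (⊤ : ℕ∞) σ 0)
    {H : E → ℝ} {x : E} {L : V →L[ℝ] ℝ} (hL : ∀ᶠ h in 𝓝 0, H (x + h) = L (σ h)) :
    ContDiffAt ℝ (⊤ : ℕ∞) H x ∧ HasFDerivAt H (L.comp (fderiv ℝ σ 0)) x := by
  have ht : Tendsto (fun y => y - x) (𝓝 x) (𝓝 0) := by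
    have : Continuous fun y : E => y - x := by fun_prop
    simpa using this.tendsto x
  have he : H =ᶠ[𝓝 x] fun y => L (σ (y - x)) := by
    filter_upwards [ht.eventually hL] with y hy
    rw [← hy, add_sub_cancel]
  have hσ' : ContDiffAt ℝ (⊤ : ℕ∞) σ (x - x) := by rwa [sub_self]
  refine ⟨ContDiffAt.congr_of_eventuallyEq (L.contDiff.contDiffAt.comp x
    (ContDiffAt.comp (f := fun y => y - x) x hσ' (contDiff_id.sub contDiff_const).contDiffAt)) he, HasFDerivAt.congr_of_eventuallyEq ?_ he⟩
  have hd : HasFDerivAt σ (fderiv ℝ σ 0) (x - x) := by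
    rw [sub_self]; exact (hσ.differentiableAt (by simp)).hasFDerivAt
  exact L.hasFDerivAt.comp x (HasFDerivAt.comp (f := fun y => y - x) x hd
    ((hasFDerivAt_id x).sub_const x))

lemma hasLineDerivAt_density {n : ℕ} {φ : EuclideanSpace ℝ (Fin n) →ᵇ ℝ}
    {σ : EuclideanSpace ℝ (Fin n) → EuclideanSpace ℝ (Fin n) →ᵇ ℝ}
    (hσ : ContDiffAt ℝ (⊤ : ℕ∞) σ 0)
    (he : ∀ᶠ h in 𝓝 0, ∀ x, decay x * σ h x = decay (x + h) * φ (x + h))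
    (e x : EuclideanSpace ℝ (Fin n)) :
    HasLineDerivAt ℝ (fun z => decay z * φ z) (decay x * fderiv ℝ σ 0 e x) x e := by
  have := (contDiffAt_of_translate hσ (H := fun z => decay z * φ z) (x := x)
    (L := decay x • BoundedContinuousFunction.evalCLM ℝ x)
    (by filter_upwards [he] with h hh using (hh x).symm)).2.hasLineDerivAt e
  simpa using this

lemma SingKernel.contDiff_conv {n s : ℕ} (hs : s + 1 ≤ n) {A : ℝ}
    {K : EuclideanSpace ℝ (Fin n) → ℝ} (hK : SingKernel s A K)
    {φ : EuclideanSpace ℝ (Fin n) →ᵇ ℝ}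
    {σ : EuclideanSpace ℝ (Fin n) → EuclideanSpace ℝ (Fin n) →ᵇ ℝ}
    (hσ : ContDiffAt ℝ (⊤ : ℕ∞) σ 0)
    (he : ∀ᶠ h in 𝓝 0, ∀ x, decay x * σ h x = decay (x + h) * φ (x + h)) :
    ContDiff ℝ (⊤ : ℕ∞) (conv K (fun z => decay z * φ z)) ∧
      ∀ e x, fderiv ℝ (conv K (fun z => decay z * φ z)) x e =
        conv K (fun z => decay z * fderiv ℝ σ 0 e z) x := by
  obtain ⟨T, hT⟩ := hK.exists_clm hs
  have hT' (ψ x) : ((((1 + ‖x‖) ^ s)⁻¹ • BoundedContinuousFunction.evalCLM ℝ x).comp T) ψ =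
      conv K (fun z => decay z * ψ z) x := by
    simp only [ContinuousLinearMap.comp_apply, _root_.smul_apply,
      BoundedContinuousFunction.evalCLM_apply, smul_eq_mul, hT]
    exact inv_mul_cancel_left₀ (by positivity) _
  have key (x) := contDiffAt_of_translate hσ (H := conv K (fun z => decay z * φ z)) (x := x)
    (L := (((1 + ‖x‖) ^ s)⁻¹ • BoundedContinuousFunction.evalCLM ℝ x).comp T) (by
      filter_upwards [he] with h hh
      rw [hT', ← conv_translate]
      simp only [hh])
  refine ⟨contDiff_iff_contDiffAt.2 fun x => (key x).1, fun e x => ?_⟩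
  rw [(key x).2.fderiv, ← hT']
  rfl

lemma fderiv_const_mul_sum {ι E : Type*} [Fintype ι] [NormedAddCommGroup E] [NormedSpace ℝ E]
    {H : ι → E → ℝ} (hH : ∀ j, ContDiff ℝ (⊤ : ℕ∞) (H j)) (c : ℝ) (x e : E) :
    fderiv ℝ (fun z => c * ∑ j, H j z) x e = c * ∑ j, fderiv ℝ (H j) x e := by
  have hd (j) : HasFDerivAt (H j) (fderiv ℝ (H j) x) x :=
    ((hH j).differentiable (by simp) x).hasFDerivAt
  rw [((HasFDerivAt.fun_sum fun j (_ : j ∈ Finset.univ) => hd j).const_mul c).fderiv]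
  simp



/-- **Existence of decaying solutions with small compactly supported force, n ≥ 4.**
There exist `ε₀ > 0` and `C > 0` depending only on `n` such that: for every smooth
vector field `f` supported in `B₃` with `‖f‖_{L^∞} ≤ ε₀`, there exist a smooth vector
field `w` and a smooth function `q` with `-Δw + (w·∇)w + ∇q = f`, `div w = 0` on `ℝⁿ`,
and `|w(x)| ≤ C ε₀ (1 + |x|)^{2-n}` for all `x`. -/
theorem steady_NS_small_force_decaying_solution {n : ℕ} (hn : 4 ≤ n) :
    ∃ ε₀ C : ℝ, 0 < ε₀ ∧ 0 < C ∧
      ∀ f : EuclideanSpace ℝ (Fin n) → EuclideanSpace ℝ (Fin n),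
        ContDiff ℝ (⊤ : ℕ∞) f →
        Function.support f ⊆ Metric.ball (0 : EuclideanSpace ℝ (Fin n)) 3 →
        (∀ x : EuclideanSpace ℝ (Fin n), ‖f x‖ ≤ ε₀) →
        ∃ (w : EuclideanSpace ℝ (Fin n) → EuclideanSpace ℝ (Fin n))
          (q : EuclideanSpace ℝ (Fin n) → ℝ),
          ContDiff ℝ (⊤ : ℕ∞) w ∧ ContDiff ℝ (⊤ : ℕ∞) q ∧
          (∀ x : EuclideanSpace ℝ (Fin n), ∀ j : Fin n,
            -(∑ i : Fin n, fderiv ℝ (fun y => fderiv ℝ (fun z => w z j) y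
                  (EuclideanSpace.single i 1)) x (EuclideanSpace.single i 1)) +
              (∑ i : Fin n, w x i * fderiv ℝ (fun z => w z j) x (EuclideanSpace.single i 1)) +
              fderiv ℝ q x (EuclideanSpace.single j 1) = f x j) ∧
          (∀ x : EuclideanSpace ℝ (Fin n),
            ∑ i : Fin n, fderiv ℝ (fun z => w z i) x (EuclideanSpace.single i 1) = 0) ∧
          (∀ x : EuclideanSpace ℝ (Fin n), ‖w x‖ ≤ C * ε₀ / (1 + ‖x‖) ^ (n - 2)) := by
  set κ := bumpMass n with hκ
  have hκ0 : 0 < κ := bumpMass_pos (by omega)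
  have hK (i j) : ∃ A, SingKernel (n - 2) A (oseen i j 0 : EuclideanSpace ℝ (Fin n) → ℝ) :=
    (exists_singKernel_oseen (by omega) i j).imp fun A hA => hA 0 le_rfl
  have hG (k i j) : ∃ A, SingKernel (n - 1) A (oseenGrad k i j 0 : EuclideanSpace ℝ (Fin n) → ℝ) :=
    (exists_singKernel_oseenGrad (by omega) k i j).imp fun A hA => hA 0 le_rfl
  have hP (j) : ∃ A, SingKernel (n - 1) A (pressure j 0 : EuclideanSpace ℝ (Fin n) → ℝ) :=
    (exists_singKernel_pressure (by omega) j).imp fun A hA => hA 0 le_rfl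
  have hM (i j : Fin n) : ∃ M : ℝ, ∀ (B : ℝ) (F : EuclideanSpace ℝ (Fin n) → ℝ), Decays B F →
      ∀ x, (1 + ‖x‖) ^ (n - 2) * |conv (oseen i j 0) F x| ≤ M * B := by
    obtain ⟨A, hA⟩ := hK i j
    exact ⟨_, fun B F hF x => hA.weighted_conv_le (by omega) hF x⟩
  choose M hM using hM
  obtain ⟨ε, hε, hsol⟩ := exists_smooth_translates hn (κ⁻¹ ^ 2) hK hG
  refine ⟨ε, (κ⁻¹ * ∑ i, ∑ j, |M i j| + 1) / ε, hε, by positivity, fun f hf hsupp hfb => ?_⟩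
  obtain ⟨φ, σ, hφ1, hσ, hσe, hfix⟩ := hsol (fun j x => f x j)
    (fun j => contDiff_euclidean.1 hf j)
    (fun j x hx => hsupp fun h0 => hx (by simp [h0]))
    (fun j x => (PiLp.norm_apply_le (f x) j).trans (hfb x))
  set F : Fin n → EuclideanSpace ℝ (Fin n) → ℝ := fun j z => decay z * φ j z with hFdef
  set F' : Fin n → Fin n → EuclideanSpace ℝ (Fin n) → ℝ := fun k j z =>
    decay z * fderiv ℝ (σ j) 0 (EuclideanSpace.single k 1) z with hF'def
  have hF (j) : Decays ‖φ j‖ (F j) := decays_decay_mul _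
  have hF' (k j) : Decays ‖fderiv ℝ (σ j) 0 (EuclideanSpace.single k 1)‖ (F' k j) :=
    decays_decay_mul _
  have hFd (k j x) : HasLineDerivAt ℝ (F j) (F' k j x) x (EuclideanSpace.single k 1) :=
    hasLineDerivAt_density (hσ j) (hσe j) _ x
  have cK (i j) := (hK i j).choose_spec.contDiff_conv (by omega) (hσ j) (hσe j)
  have cG (k i j) := (hG k i j).choose_spec.contDiff_conv (by omega) (hσ j) (hσe j)
  have cP (j) := (hP j).choose_spec.contDiff_conv (by omega) (hσ j) (hσe j)
  let w : EuclideanSpace ℝ (Fin n) → EuclideanSpace ℝ (Fin n) := fun x =>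
    WithLp.toLp 2 fun i => κ⁻¹ * ∑ j, conv (oseen i j 0) (F j) x
  have hw (x i) : w x i = κ⁻¹ * ∑ j, conv (oseen i j 0) (F j) x := rfl
  have hwd (i k x) : fderiv ℝ (fun z => w z i) x (EuclideanSpace.single k 1) =
      κ⁻¹ * ∑ j, conv (oseenGrad k i j 0) (F j) x := by
    simp only [hw]
    rw [fderiv_const_mul_sum fun j => (cK i j).1]
    congr 1
    refine Finset.sum_congr rfl fun j _ => ?_
    rw [(cK i j).2, conv_oseen_deriv (by omega) k i j (hF j) (hF' k j) (hFd k j)]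
  have hwdd (i k x) : fderiv ℝ (fun y => fderiv ℝ (fun z => w z i) y
      (EuclideanSpace.single k 1)) x (EuclideanSpace.single k 1) =
      κ⁻¹ * ∑ j, conv (oseenGrad k i j 0) (F' k j) x := by
    simp only [hwd]
    rw [fderiv_const_mul_sum fun j => (cG k i j).1]
    simp only [(cG k i _).2, hF'def]
  refine ⟨w, fun x => κ⁻¹ * ∑ j, conv (pressure j 0) (F j) x, ?_, ?_, fun x i => ?_, fun x => ?_,
    fun x => ?_⟩
  · exact contDiff_euclidean.2 fun i => contDiff_const.mul (ContDiff.sum fun j _ => (cK i j).1)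
  · exact contDiff_const.mul (ContDiff.sum fun j _ => (cP j).1)
  · have hq : fderiv ℝ (fun x => κ⁻¹ * ∑ j, conv (pressure j 0) (F j) x) x
        (EuclideanSpace.single i 1) = κ⁻¹ * ∑ j, conv (pressure j 0) (F' i j) x := by
      rw [fderiv_const_mul_sum fun j => (cP j).1]
      simp only [(cP _).2, hF'def]
    have hstokes : ∑ j, (∑ k, conv (oseenGrad k i j 0) (F' k j) x -
        conv (pressure j 0) (F' i j) x) = -(κ * F i x) := by
      simp only [sum_conv_oseenGrad_deriv (by omega : 3 ≤ n) i _ (hF _) (fun k => hF' k _)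
        (fun k => hFd k _)]
      rw [Finset.sum_neg_distrib, sum_kron_mul_right i fun j => bumpMass n * F j x]
    rw [hq, ← hfix i x]
    simp only [hwdd]
    simp only [hwd, hw x]
    rw [← Finset.mul_sum, Finset.sum_comm]
    rw [Finset.sum_sub_distrib] at hstokes
    have hconv : ∑ k, κ⁻¹ * (∑ j, conv (oseen k j 0) (F j) x) *
        (κ⁻¹ * ∑ j, conv (oseenGrad k i j 0) (F j) x) =
        κ⁻¹ ^ 2 * ∑ k, (∑ j, conv (oseen k j 0) (F j) x) *
          ∑ j, conv (oseenGrad k i j 0) (F j) x := by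
      rw [Finset.mul_sum]
      exact Finset.sum_congr rfl fun k _ => by ring
    rw [hconv]
    have hFi : F i x = -(κ⁻¹ * -(κ * F i x)) := by field_simp
    change _ = F i x + _
    rw [hFi, ← hstokes]
    ring
  · simp only [hwd]
    rw [← Finset.mul_sum, Finset.sum_comm]
    simp only [sum_conv_oseenGrad (by omega : 2 ≤ n) _ (hF _)]
    simp
  · have hx : 0 < (1 + ‖x‖) ^ (n - 2) := by positivity
    rw [div_mul_cancel₀ _ hε.ne', le_div_iff₀' hx]
    have hb (i j) : (1 + ‖x‖) ^ (n - 2) * |conv (oseen i j 0) (F j) x| ≤ |M i j| :=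
      (hM i j _ _ (hF j) x).trans <| (mul_le_mul_of_nonneg_right (le_abs_self _)
        (norm_nonneg _)).trans (mul_le_of_le_one_right (abs_nonneg _) (hφ1 j))
    have hnorm : ‖w x‖ ≤ κ⁻¹ * ∑ i, ∑ j, |conv (oseen i j 0) (F j) x| := by
      have h1 : ‖w x‖ ≤ ∑ i, |w x i| := by
        rw [EuclideanSpace.norm_eq]
        exact Real.sqrt_le_iff.2 ⟨by positivity,
          Finset.sum_sq_le_sq_sum_of_nonneg fun i _ => norm_nonneg (w x i)⟩
      refine h1.trans ?_
      rw [Finset.mul_sum]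
      refine Finset.sum_le_sum fun i _ => ?_
      rw [hw, abs_mul, abs_of_pos (inv_pos.2 hκ0)]
      exact mul_le_mul_of_nonneg_left (Finset.abs_sum_le_sum_abs _ _) (inv_pos.2 hκ0).le
    calc _ ≤ (1 + ‖x‖) ^ (n - 2) * (κ⁻¹ * ∑ i, ∑ j, |conv (oseen i j 0) (F j) x|) := by gcongr
      _ = κ⁻¹ * ∑ i, ∑ j, (1 + ‖x‖) ^ (n - 2) * |conv (oseen i j 0) (F j) x| := by
        simp only [← Finset.mul_sum]; ring
      _ ≤ κ⁻¹ * ∑ i, ∑ j, |M i j| := by gcongr; exact hb _ _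
      _ ≤ _ := by linarith
end

section
/- Let n ≥ 4. There exists a constant C = C(n) such that for all x ∈ ℝⁿ, ∫_{ℝⁿ} |x − y|^{-(n−1)} (1 + |y|)^{-2(n−2)} dy ≤ C (1 + |x|)^{-(n−2)}. -/
open MeasureTheory

/-- Pointwise bound for the weighted kernel away from its singularity. -/
theorem weighted_kernel_le_of_one_le {k : ℕ} {d b R : ℝ} (hd : 1 ≤ d) (hb : 1 ≤ b) (hR : 0 < R)
    (h : R ≤ b + d) :
    1 / (d ^ (k + 3) * b ^ (2 * (k + 2))) ≤
      2 ^ (2 * k + 5) / R ^ (k + 2) * (1 / (1 + d) ^ (2 * k + 5) + 1 / b ^ (2 * k + 5)) := by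
  have hb0 : 0 < b := by linarith
  have hd0 : 0 < d := by linarith
  have key : ∀ m : ℝ, 0 < m → m ≤ 1 + d → m ≤ b →
      1 / (d ^ (k + 3) * b ^ (2 * (k + 2))) ≤
        2 ^ (2 * k + 5) / R ^ (k + 2) * (1 / m ^ (2 * k + 5)) := by
    intro m hm hmd hmb
    have hm2 : m ≤ 2 * d := by linarith
    rw [div_mul_div_comm, mul_one, div_le_div_iff₀ (by positivity) (by positivity), one_mul]
    rcases le_total b (2 * d) with hbd | hbd
    · calc R ^ (k + 2) * m ^ (2 * k + 5)
          = R ^ (k + 2) * (m * m ^ (2 * (k + 2))) := by ring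
        _ ≤ (2 * (2 * d)) ^ (k + 2) * ((2 * d) * b ^ (2 * (k + 2))) := by
          gcongr
          linarith
        _ = 2 ^ (2 * k + 5) * (d ^ (k + 3) * b ^ (2 * (k + 2))) := by
          simp only [mul_pow]; ring
    · calc R ^ (k + 2) * m ^ (2 * k + 5)
          = R ^ (k + 2) * (m ^ (k + 3) * m ^ (k + 2)) := by ring
        _ ≤ (2 * b) ^ (k + 2) * ((2 * d) ^ (k + 3) * b ^ (k + 2)) := by
          gcongr
          linarith
        _ = 2 ^ (2 * k + 5) * (d ^ (k + 3) * b ^ (2 * (k + 2))) := by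
          simp only [mul_pow]; ring
  rcases le_total (1 + d) b with hdb | hdb
  · refine (key (1 + d) (by linarith) le_rfl hdb).trans ?_
    gcongr
    exact le_add_of_nonneg_right (by positivity)
  · refine (key b hb0 hdb le_rfl).trans ?_
    gcongr
    exact le_add_of_nonneg_left (by positivity)

/-- Pointwise bound for the weighted kernel near its singularity. -/
theorem weighted_kernel_le_of_le_one {k : ℕ} {d b R : ℝ} (hd0 : 0 ≤ d) (hd : d ≤ 1) (hb : 1 ≤ b)
    (hR : 0 < R) (h : R ≤ b + d) :
    1 / (d ^ (k + 3) * b ^ (2 * (k + 2))) ≤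
      2 ^ (2 * k + 5) / R ^ (k + 2) * (1 / d ^ (k + 3)) := by
  have hb0 : 0 < b := by linarith
  rw [← one_div_mul_one_div, mul_comm]
  refine mul_le_mul_of_nonneg_right ?_ (by positivity)
  rw [div_le_div_iff₀ (by positivity) (by positivity), one_mul]
  calc R ^ (k + 2) ≤ (2 * b) ^ (k + 2) := by gcongr; linarith
    _ = 2 ^ (k + 2) * b ^ (k + 2) := mul_pow _ _ _
    _ ≤ 2 ^ (2 * k + 5) * b ^ (2 * (k + 2)) := by
      exact mul_le_mul (pow_le_pow_right₀ one_le_two (by omega))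
        (pow_le_pow_right₀ hb (by omega)) (by positivity) (by positivity)

theorem lintegral_one_div_one_add_norm_pow_lt_top {n m : ℕ} (h : n < m) :
    ∫⁻ z : EuclideanSpace ℝ (Fin n), ENNReal.ofReal (1 / (1 + ‖z‖) ^ m) < ⊤ := by
  have := finite_integral_one_add_norm (E := EuclideanSpace ℝ (Fin n)) (μ := volume) (r := m)
    (by simpa using h)
  refine lt_of_eq_of_lt (lintegral_congr fun z => ?_) this
  rw [Real.rpow_neg (by positivity), Real.rpow_natCast, one_div]

theorem lintegral_ball_one_div_norm_pow_lt_top (m : ℕ) :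
    ∫⁻ z : EuclideanSpace ℝ (Fin (m + 1)) in Metric.ball 0 1,
      ENNReal.ofReal (1 / ‖z‖ ^ m) < ⊤ := by
  have : IntegrableOn (fun z : EuclideanSpace ℝ (Fin (m + 1)) => 1 / ‖z‖ ^ m)
      (Metric.ball 0 1) := by
    refine (integrableOn_fun_norm_addHaar volume (f := fun t : ℝ => 1 / t ^ m)).2 ?_
    refine (integrableOn_const (C := (1 : ℝ)) (by simp)).congr_fun (fun t ht => ?_)
      measurableSet_Ioo
    have : t ^ m ≠ 0 := pow_ne_zero _ ht.1.ne'
    simp [this]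
  exact Integrable.lintegral_lt_top this

/-- **Kernel estimate for the bilinear term, n ≥ 4.**
There is a constant `C = C(n)` such that for all `x ∈ ℝⁿ`,
`∫_{ℝⁿ} |x-y|^{-(n-1)} (1+|y|)^{-2(n-2)} dy ≤ C (1+|x|)^{-(n-2)}`. -/
theorem kernel_estimate_weighted {n : ℕ} (hn : 4 ≤ n) :
    ∃ C : ℝ, 0 < C ∧ ∀ x : EuclideanSpace ℝ (Fin n),
      ∫⁻ y : EuclideanSpace ℝ (Fin n),
          ENNReal.ofReal (1 / (‖x - y‖ ^ (n - 1) * (1 + ‖y‖) ^ (2 * (n - 2)))) ∂volume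
        ≤ ENNReal.ofReal (C / (1 + ‖x‖) ^ (n - 2)) := by
  obtain ⟨k, rfl⟩ := Nat.exists_eq_add_of_le' hn
  simp only [show k + 4 - 1 = k + 3 by omega, show k + 4 - 2 = k + 2 by omega]
  set E := EuclideanSpace ℝ (Fin (k + 4))
  let N : E → ENNReal := (Metric.ball 0 1).indicator fun z => ENNReal.ofReal (1 / ‖z‖ ^ (k + 3))
  let F : E → ENNReal := fun z => ENNReal.ofReal (1 / (1 + ‖z‖) ^ (2 * k + 5))
  have hNm : Measurable N := Measurable.indicator (by fun_prop) measurableSet_ball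
  have hFm : Measurable F := by fun_prop
  have hN : ∫⁻ z, N z ≠ ⊤ := by
    rw [lintegral_indicator measurableSet_ball]
    exact (lintegral_ball_one_div_norm_pow_lt_top (k + 3)).ne
  have hF : ∫⁻ z, F z ≠ ⊤ := (lintegral_one_div_one_add_norm_pow_lt_top (by omega)).ne
  set I : ENNReal := (∫⁻ z, N z) + ((∫⁻ z, F z) + ∫⁻ z, F z)
  have hI : I ≠ ⊤ := ENNReal.add_ne_top.2 ⟨hN, ENNReal.add_ne_top.2 ⟨hF, hF⟩⟩
  refine ⟨2 ^ (2 * k + 5) * (I.toReal + 1), by positivity, fun x => ?_⟩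
  have hR : 0 < 1 + ‖x‖ := by positivity
  set A : ℝ := 2 ^ (2 * k + 5) / (1 + ‖x‖) ^ (k + 2)
  have hA : 0 ≤ A := by positivity
  have hpt (y : E) : ENNReal.ofReal (1 / (‖x - y‖ ^ (k + 3) * (1 + ‖y‖) ^ (2 * (k + 2)))) ≤
      ENNReal.ofReal A * (N (x - y) + (F (x - y) + F y)) := by
    have hxy : 1 + ‖x‖ ≤ 1 + ‖y‖ + ‖x - y‖ := by
      linarith [norm_le_norm_add_norm_sub y x, norm_sub_rev x y]
    have hy : 1 ≤ 1 + ‖y‖ := le_add_of_nonneg_right (norm_nonneg y)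
    rcases lt_or_ge ‖x - y‖ 1 with hd | hd
    · have hNx : N (x - y) = ENNReal.ofReal (1 / ‖x - y‖ ^ (k + 3)) :=
        Set.indicator_of_mem (by simpa using hd) _
      refine le_trans ?_ (mul_le_mul_right le_self_add _)
      rw [hNx, ← ENNReal.ofReal_mul hA]
      exact ENNReal.ofReal_le_ofReal
        (weighted_kernel_le_of_le_one (norm_nonneg _) hd.le hy hR hxy)
    · refine le_trans ?_ (mul_le_mul_right le_add_self _)
      rw [← ENNReal.ofReal_add (by positivity) (by positivity), ← ENNReal.ofReal_mul hA]
      exact ENNReal.ofReal_le_ofReal (weighted_kernel_le_of_one_le hd hy hR hxy)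
  calc
    _ ≤ ∫⁻ y, ENNReal.ofReal A * (N (x - y) + (F (x - y) + F y)) := lintegral_mono hpt
    _ = ENNReal.ofReal A * I := by
      rw [lintegral_const_mul' _ _ ENNReal.ofReal_ne_top, lintegral_add_left (by fun_prop),
        lintegral_add_left (by fun_prop), lintegral_sub_left_eq_self N,
        lintegral_sub_left_eq_self F]
    _ = ENNReal.ofReal (A * I.toReal) := by
      rw [ENNReal.ofReal_mul hA, ENNReal.ofReal_toReal hI]
    _ ≤ _ := by
      refine ENNReal.ofReal_le_ofReal ?_
      rw [mul_div_right_comm]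
      gcongr
      linarith
end

section
/- Let n ≥ 4 and let (u, p) be a smooth solution of the steady Navier-Stokes equations on Ω = ℝⁿ₊ \ {0} with |u(x)| ≤ C/|x| on Ω, extending smoothly up to ∂ℝⁿ₊ \ {0} and satisfying there the Navier slip conditions uₙ = 0 and ∂ₙ uᵢ = 0 for i = 1, …, n−1. Define ũ on ℝⁿ \ {0} by ũ(x′, xₙ) = (u₁, …, u_{n−1}, uₙ)(x′, xₙ) for xₙ > 0 and ũ(x′, xₙ) = (u₁(x′, −xₙ), …, u_{n−1}(x′, −xₙ), −uₙ(x′, −xₙ)) for xₙ < 0 (with the continuous extension on {xₙ = 0} \ {0}), and define p̃(x′, xₙ) = p(x′, |xₙ|). Then (ũ, p̃) is a smooth solution of the steady Navier-Stokes equations on ℝⁿ \ {0}, and |ũ(x)| ≤ C/|x| for all x ≠ 0. -/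
noncomputable section

namespace SlipReflection

open Set Filter Topology

variable {n : ℕ} {l : Fin n}

/-- The closed upper half space with the origin removed. -/
def upper (l : Fin n) : Set (EuclideanSpace ℝ (Fin n)) :=
  {x : EuclideanSpace ℝ (Fin n) | 0 ≤ x l} \ {0}

/-- The mirror map changing the sign of the `l`-th coordinate. -/
def mirror (l : Fin n) : EuclideanSpace ℝ (Fin n) →L[ℝ] EuclideanSpace ℝ (Fin n) :=
  ContinuousLinearMap.id ℝ _ -
    (2 : ℝ) • (EuclideanSpace.proj l).smulRight (EuclideanSpace.single l (1 : ℝ))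

/-- The parity of the `i`-th coordinate under the mirror map. -/
def parity (l i : Fin n) : ℝ := if i = l then -1 else 1

/-- One-sided partial derivative on the closed upper half space. -/
def pd (l i : Fin n) (f : EuclideanSpace ℝ (Fin n) → ℝ) (x : EuclideanSpace ℝ (Fin n)) : ℝ :=
  fderivWithin ℝ f (upper l) x (EuclideanSpace.single i 1)

/-- Reflection of a function on the upper half space, even for `s = 1` and odd for `s = -1`. -/
def extend (l : Fin n) (s : ℝ) (f : EuclideanSpace ℝ (Fin n) → ℝ)
    (x : EuclideanSpace ℝ (Fin n)) : ℝ :=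
  if 0 ≤ x l then f x else s * f (mirror l x)

/-- `f` is smooth up to the boundary, and vanishes there if it is odd. -/
structure Admissible (l : Fin n) (f : EuclideanSpace ℝ (Fin n) → ℝ) (s : ℝ) : Prop where
  contDiffOn : ContDiffOn ℝ (⊤ : ℕ∞) f (upper l)
  sign : s = 1 ∨ s = -1
  vanish : s = -1 → ∀ x : EuclideanSpace ℝ (Fin n), x l = 0 → x ≠ 0 → f x = 0

/-- `f` is smooth up to the boundary, and those among its normal derivatives of order at most
`k` which are odd under the reflection of parity `s` vanish on the boundary. -/
inductive Compat (l : Fin n) : ℕ → (EuclideanSpace ℝ (Fin n) → ℝ) → ℝ → Prop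
  | zero {f : EuclideanSpace ℝ (Fin n) → ℝ} {s : ℝ} (h : Admissible l f s) : Compat l 0 f s
  | succ {k : ℕ} {f : EuclideanSpace ℝ (Fin n) → ℝ} {s : ℝ} (h : Admissible l f s)
      (h' : Compat l k (pd l l f) (-s)) : Compat l (k + 1) f s

theorem mirror_apply (x : EuclideanSpace ℝ (Fin n)) (i : Fin n) :
    mirror l x i = parity l i * x i := by
  by_cases h : i = l
  · subst h; simp [mirror, parity]; ring
  · simp [mirror, parity, h]

theorem parity_self : parity l l = -1 := by simp [parity]

theorem parity_of_ne {i : Fin n} (h : i ≠ l) : parity l i = 1 := by simp [parity, h]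

theorem parity_cases (i : Fin n) : parity l i = 1 ∨ parity l i = -1 := by
  unfold parity; split_ifs <;> simp

theorem parity_mul_self (i : Fin n) : parity l i * parity l i = 1 := by
  rcases parity_cases (l := l) i with h | h <;> simp [h]

theorem mirror_mirror (x : EuclideanSpace ℝ (Fin n)) : mirror l (mirror l x) = x := by
  ext i
  rw [mirror_apply, mirror_apply, ← mul_assoc, parity_mul_self, one_mul]

theorem mirror_ne_zero {x : EuclideanSpace ℝ (Fin n)} (hx : x ≠ 0) : mirror l x ≠ 0 := by
  intro h
  apply hx
  rw [← mirror_mirror (l := l) x, h, map_zero]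

theorem norm_mirror (x : EuclideanSpace ℝ (Fin n)) : ‖mirror l x‖ = ‖x‖ := by
  rw [EuclideanSpace.norm_eq, EuclideanSpace.norm_eq]
  congr 1
  refine Finset.sum_congr rfl fun i _ => ?_
  rw [mirror_apply]
  rcases parity_cases (l := l) i with h | h <;> simp [h]

theorem mirror_self_of_eq_zero {x : EuclideanSpace ℝ (Fin n)} (hx : x l = 0) :
    mirror l x = x := by
  ext i
  rw [mirror_apply]
  by_cases h : i = l
  · subst h; simp [hx]
  · simp [parity, h]

theorem mirror_single (i : Fin n) :
    mirror l (EuclideanSpace.single i 1) = parity l i • EuclideanSpace.single i (1 : ℝ) := by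
  ext j
  rw [mirror_apply]
  by_cases h : j = i
  · subst h; simp
  · simp [h]

theorem mirror_mem_upper {x : EuclideanSpace ℝ (Fin n)} (hx : x l ≤ 0) (h0 : x ≠ 0) :
    mirror l x ∈ upper l := by
  refine ⟨?_, mirror_ne_zero h0⟩
  simp only [mem_ofPred_eq, mirror_apply, parity_self]
  linarith

theorem uniqueDiffOn_halfSpace :
    UniqueDiffOn ℝ {x : EuclideanSpace ℝ (Fin n) | 0 ≤ x l} := by
  apply uniqueDiffOn_convex
  · exact (convex_Ici (0 : ℝ)).linear_preimage (EuclideanSpace.proj l).toLinearMap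
  · refine ⟨EuclideanSpace.single l 1, ?_⟩
    apply mem_interior.2
    refine ⟨{x | 0 < x l}, fun x (hx : 0 < x l) => hx.le, ?_, by simp⟩
    exact isOpen_lt continuous_const (EuclideanSpace.proj (𝕜 := ℝ) l).continuous

theorem uniqueDiffOn_upper : UniqueDiffOn ℝ (upper l) := by
  have := (uniqueDiffOn_halfSpace (l := l)).inter (isOpen_compl_singleton (x := 0))
  exact this

theorem upper_mem_nhds {x : EuclideanSpace ℝ (Fin n)} (hx : 0 < x l) : upper l ∈ 𝓝 x := by
  have ho : IsOpen {y : EuclideanSpace ℝ (Fin n) | 0 < y l} :=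
    isOpen_lt continuous_const (EuclideanSpace.proj (𝕜 := ℝ) l).continuous
  filter_upwards [ho.mem_nhds hx] with y hy
  refine ⟨le_of_lt hy, ?_⟩
  rintro rfl
  simp at hy

theorem upper_subset_closure :
    upper l ⊆ closure {x : EuclideanSpace ℝ (Fin n) | 0 < x l} := by
  intro x hx
  rw [mem_closure_iff_seq_limit]
  refine ⟨fun k => x + (1 / ((k : ℝ) + 1)) • EuclideanSpace.single l 1, fun k => ?_, ?_⟩
  · have h1 : 0 ≤ x l := hx.1
    have h2 : 0 < 1 / ((k : ℝ) + 1) := by positivity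
    simp only [mem_ofPred_eq, PiLp.add_apply, PiLp.smul_apply, smul_eq_mul]
    simp only [PiLp.single_apply, if_true]
    linarith
  · have := (tendsto_one_div_add_atTop_nhds_zero_nat (𝕜 := ℝ)).smul_const
      (EuclideanSpace.single l (1 : ℝ))
    simpa using this.const_add x

theorem eqOn_upper {f g : EuclideanSpace ℝ (Fin n) → ℝ}
    (hf : ContDiffOn ℝ (⊤ : ℕ∞) f (upper l)) (hg : ContDiffOn ℝ (⊤ : ℕ∞) g (upper l))
    (h : ∀ x : EuclideanSpace ℝ (Fin n), 0 < x l → f x = g x) : EqOn f g (upper l) :=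
  EqOn.of_subset_closure (s := {x : EuclideanSpace ℝ (Fin n) | 0 < x l}) h
    hf.continuousOn hg.continuousOn (fun _ hx => mem_of_mem_nhds (upper_mem_nhds hx))
    upper_subset_closure

theorem contDiffOn_pd (i : Fin n) {f : EuclideanSpace ℝ (Fin n) → ℝ}
    (hf : ContDiffOn ℝ (⊤ : ℕ∞) f (upper l)) : ContDiffOn ℝ (⊤ : ℕ∞) (pd l i f) (upper l) :=
  (hf.fderivWithin uniqueDiffOn_upper (by simp)).clm_apply contDiffOn_const

theorem differentiableWithinAt_upper {f : EuclideanSpace ℝ (Fin n) → ℝ}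
    (hf : ContDiffOn ℝ (⊤ : ℕ∞) f (upper l)) {x : EuclideanSpace ℝ (Fin n)}
    (hx : x ∈ upper l) : DifferentiableWithinAt ℝ f (upper l) x :=
  hf.differentiableOn (by simp) x hx

theorem pd_congr {f g : EuclideanSpace ℝ (Fin n) → ℝ} (h : EqOn f g (upper l)) (i : Fin n) :
    EqOn (pd l i f) (pd l i g) (upper l) := by
  intro x hx
  simp only [pd, fderivWithin_congr h (h hx)]

theorem pd_comm {f : EuclideanSpace ℝ (Fin n) → ℝ}
    (hf : ContDiffOn ℝ (⊤ : ℕ∞) f (upper l)) (i j : Fin n) :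
    EqOn (pd l i (pd l j f)) (pd l j (pd l i f)) (upper l) := by
  intro x hx
  have key : ∀ a b : Fin n, pd l a (pd l b f) x =
      fderivWithin ℝ (fderivWithin ℝ f (upper l)) (upper l) x
        (EuclideanSpace.single a 1) (EuclideanSpace.single b 1) := by
    intro a b
    have h1 : DifferentiableWithinAt ℝ (fderivWithin ℝ f (upper l)) (upper l) x :=
      (hf.fderivWithin (m := 1) uniqueDiffOn_upper (by norm_cast)).differentiableOn (by simp) x hx
    change fderivWithin ℝ (fun y => fderivWithin ℝ f (upper l) y (EuclideanSpace.single b 1))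
      (upper l) x (EuclideanSpace.single a 1) = _
    rw [fderivWithin_clm_apply (uniqueDiffOn_upper x hx) h1 (differentiableWithinAt_const _)]
    simp
  rw [key, key]
  refine (ContDiffWithinAt.isSymmSndFDerivWithinAt (hf x hx) (by simp; norm_cast)
    uniqueDiffOn_upper ?_ hx).eq _ _
  refine closure_mono ?_ (upper_subset_closure hx)
  exact fun y hy => mem_interior_iff_mem_nhds.2 (upper_mem_nhds hy)

theorem pd_add {f g : EuclideanSpace ℝ (Fin n) → ℝ}
    (hf : ContDiffOn ℝ (⊤ : ℕ∞) f (upper l)) (hg : ContDiffOn ℝ (⊤ : ℕ∞) g (upper l))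
    (i : Fin n) :
    EqOn (pd l i (fun x => f x + g x)) (fun x => pd l i f x + pd l i g x) (upper l) := by
  intro x hx
  simp only [pd]
  rw [fderivWithin_fun_add (uniqueDiffOn_upper x hx) (differentiableWithinAt_upper hf hx)
    (differentiableWithinAt_upper hg hx)]
  rfl

theorem pd_mul {f g : EuclideanSpace ℝ (Fin n) → ℝ}
    (hf : ContDiffOn ℝ (⊤ : ℕ∞) f (upper l)) (hg : ContDiffOn ℝ (⊤ : ℕ∞) g (upper l))
    (i : Fin n) :
    EqOn (pd l i (fun x => f x * g x)) (fun x => f x * pd l i g x + pd l i f x * g x)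
      (upper l) := by
  intro x hx
  simp only [pd]
  rw [fderivWithin_fun_mul (uniqueDiffOn_upper x hx) (differentiableWithinAt_upper hf hx)
    (differentiableWithinAt_upper hg hx)]
  simp [mul_comm]

theorem pd_zero (i : Fin n) : pd l i (fun _ => (0 : ℝ)) = fun _ => 0 := by
  funext x
  simp [pd]

theorem pd_neg (f : EuclideanSpace ℝ (Fin n) → ℝ) (i : Fin n) :
    EqOn (pd l i (fun x => -f x)) (fun x => -pd l i f x) (upper l) := by
  intro x hx
  simp only [pd]
  rw [fderivWithin_fun_neg (uniqueDiffOn_upper x hx)]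
  rfl

/-- Tangential derivatives of a function vanishing on the boundary vanish there. -/
theorem pd_eq_zero_of_boundary {f : EuclideanSpace ℝ (Fin n) → ℝ}
    (hf : ContDiffOn ℝ (⊤ : ℕ∞) f (upper l))
    (h0 : ∀ x : EuclideanSpace ℝ (Fin n), x l = 0 → x ≠ 0 → f x = 0)
    {i : Fin n} (hi : i ≠ l) {x : EuclideanSpace ℝ (Fin n)} (hx : x l = 0) (hx0 : x ≠ 0) :
    pd l i f x = 0 := by
  have hxu : x ∈ upper l := ⟨hx.ge, hx0⟩
  let γ : ℝ → EuclideanSpace ℝ (Fin n) := fun t => x + t • EuclideanSpace.single i 1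
  have hγ0 : γ 0 = x := by simp [γ]
  have hγl : ∀ t, γ t l = 0 := fun t => by simp [γ, hx, hi.symm]
  have hγc : Continuous γ := by fun_prop
  have hγd : HasDerivAt γ (EuclideanSpace.single i 1) 0 := by
    have h := ((hasDerivAt_id (0 : ℝ)).smul_const (EuclideanSpace.single i (1 : ℝ))).const_add x
    rw [one_smul] at h
    exact h
  let T : Set ℝ := {t | γ t ≠ 0}
  have hT : T ∈ 𝓝 (0 : ℝ) :=
    (isOpen_compl_singleton.preimage hγc).mem_nhds (by simpa [hγ0] using hx0)
  have hd := (differentiableWithinAt_upper hf hxu).hasFDerivWithinAt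
  rw [← hγ0] at hd
  have h1 := hd.comp_hasDerivWithinAt (0 : ℝ) (hγd.hasDerivWithinAt (s := T))
    (fun t ht => ⟨(hγl t).ge, ht⟩)
  have h2 := h1.hasDerivAt hT
  have h3 : (f ∘ γ) =ᶠ[𝓝 0] fun _ => 0 := by
    filter_upwards [hT] with t ht using h0 _ (hγl t) ht
  have h4 := h2.unique ((hasDerivAt_const (0 : ℝ) (0 : ℝ)).congr_of_eventuallyEq h3)
  rw [hγ0] at h4
  exact h4

theorem Admissible.congr {f g : EuclideanSpace ℝ (Fin n) → ℝ} {s : ℝ}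
    (h : Admissible l f s) (hfg : EqOn g f (upper l)) : Admissible l g s where
  contDiffOn := h.contDiffOn.congr hfg
  sign := h.sign
  vanish hs x hx hx0 := by
    rw [hfg ⟨hx.ge, hx0⟩]
    exact h.vanish hs x hx hx0

theorem Admissible.add {f g : EuclideanSpace ℝ (Fin n) → ℝ} {s : ℝ}
    (hf : Admissible l f s) (hg : Admissible l g s) :
    Admissible l (fun x => f x + g x) s where
  contDiffOn := hf.contDiffOn.add hg.contDiffOn
  sign := hf.sign
  vanish hs x hx hx0 := by simp only [hf.vanish hs x hx hx0, hg.vanish hs x hx hx0, add_zero]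

theorem Admissible.neg {f : EuclideanSpace ℝ (Fin n) → ℝ} {s : ℝ}
    (hf : Admissible l f s) : Admissible l (fun x => -f x) s where
  contDiffOn := hf.contDiffOn.neg
  sign := hf.sign
  vanish hs x hx hx0 := by simp only [hf.vanish hs x hx hx0, neg_zero]

theorem Admissible.mul {f g : EuclideanSpace ℝ (Fin n) → ℝ} {s t : ℝ}
    (hf : Admissible l f s) (hg : Admissible l g t) :
    Admissible l (fun x => f x * g x) (s * t) where
  contDiffOn := hf.contDiffOn.mul hg.contDiffOn
  sign := by rcases hf.sign with rfl | rfl <;> rcases hg.sign with rfl | rfl <;> simp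
  vanish hst x hx hx0 := by
    rcases hf.sign with rfl | rfl
    · simp only [hg.vanish (by simpa using hst) x hx hx0, mul_zero]
    · simp only [hf.vanish rfl x hx hx0, zero_mul]

theorem Admissible.pd_tangential {f : EuclideanSpace ℝ (Fin n) → ℝ} {s : ℝ}
    (hf : Admissible l f s) {i : Fin n} (hi : i ≠ l) : Admissible l (pd l i f) s where
  contDiffOn := contDiffOn_pd i hf.contDiffOn
  sign := hf.sign
  vanish hs _ hx hx0 := pd_eq_zero_of_boundary hf.contDiffOn (hf.vanish hs) hi hx hx0

theorem Compat.admissible {k : ℕ} {f : EuclideanSpace ℝ (Fin n) → ℝ} {s : ℝ}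
    (h : Compat l k f s) : Admissible l f s := by
  cases h <;> assumption

theorem Compat.pd_normal {k : ℕ} {f : EuclideanSpace ℝ (Fin n) → ℝ} {s : ℝ}
    (h : Compat l (k + 1) f s) : Compat l k (pd l l f) (-s) := by
  cases h; assumption

theorem Compat.contDiffOn {k : ℕ} {f : EuclideanSpace ℝ (Fin n) → ℝ} {s : ℝ}
    (h : Compat l k f s) : ContDiffOn ℝ (⊤ : ℕ∞) f (upper l) := h.admissible.contDiffOn

theorem Compat.congr {k : ℕ} {f g : EuclideanSpace ℝ (Fin n) → ℝ} {s : ℝ}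
    (h : Compat l k f s) (hfg : EqOn g f (upper l)) : Compat l k g s := by
  induction h generalizing g with
  | zero h => exact .zero (h.congr hfg)
  | succ h _ ih => exact .succ (h.congr hfg) (ih (pd_congr hfg l))

theorem Compat.of_succ {k : ℕ} {f : EuclideanSpace ℝ (Fin n) → ℝ} {s : ℝ}
    (h : Compat l (k + 1) f s) : Compat l k f s := by
  induction k generalizing f s with
  | zero => exact .zero h.admissible
  | succ k ih => exact .succ h.admissible (ih h.pd_normal)

theorem Compat.add {k : ℕ} {f g : EuclideanSpace ℝ (Fin n) → ℝ} {s : ℝ}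
    (hf : Compat l k f s) (hg : Compat l k g s) : Compat l k (fun x => f x + g x) s := by
  induction k generalizing f g s with
  | zero => exact .zero (hf.admissible.add hg.admissible)
  | succ k ih =>
    exact .succ (hf.admissible.add hg.admissible)
      ((ih hf.pd_normal hg.pd_normal).congr (pd_add hf.contDiffOn hg.contDiffOn l))

theorem Compat.neg {k : ℕ} {f : EuclideanSpace ℝ (Fin n) → ℝ} {s : ℝ}
    (hf : Compat l k f s) : Compat l k (fun x => -f x) s := by
  induction hf with
  | zero h => exact .zero h.neg
  | succ h _ ih => exact .succ h.neg (ih.congr (pd_neg _ l))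

theorem compat_zero_fun (k : ℕ) {s : ℝ} (hs : s = 1 ∨ s = -1) :
    Compat l k (fun _ => (0 : ℝ)) s := by
  induction k generalizing s with
  | zero => exact .zero ⟨contDiffOn_const, hs, fun _ _ _ _ => rfl⟩
  | succ k ih =>
    refine .succ ⟨contDiffOn_const, hs, fun _ _ _ _ => rfl⟩ ?_
    rw [pd_zero]
    exact ih (by rcases hs with h | h <;> simp [h])

theorem Compat.sum {k : ℕ} {ι : Type*} (t : Finset ι) {F : ι → EuclideanSpace ℝ (Fin n) → ℝ}
    {s : ℝ} (hs : s = 1 ∨ s = -1) (hF : ∀ i ∈ t, Compat l k (F i) s) :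
    Compat l k (fun x => ∑ i ∈ t, F i x) s := by
  classical
  induction t using Finset.induction_on with
  | empty => simpa using compat_zero_fun k hs
  | insert a t ha ih =>
    simp only [Finset.sum_insert ha]
    exact (hF a (by simp)).add (ih fun i hi => hF i (by simp [hi]))

theorem Compat.mul {k : ℕ} {f g : EuclideanSpace ℝ (Fin n) → ℝ} {s t : ℝ}
    (hf : Compat l k f s) (hg : Compat l k g t) :
    Compat l k (fun x => f x * g x) (s * t) := by
  induction k generalizing f g s t with
  | zero => exact .zero (hf.admissible.mul hg.admissible)
  | succ k ih =>
    refine .succ (hf.admissible.mul hg.admissible) ?_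
    have h1 := ih hf.of_succ hg.pd_normal
    have h2 := ih hf.pd_normal hg.of_succ
    rw [mul_neg] at h1
    rw [neg_mul] at h2
    exact (h1.add h2).congr (pd_mul hf.contDiffOn hg.contDiffOn l)

theorem Compat.pd_tangential {k : ℕ} {f : EuclideanSpace ℝ (Fin n) → ℝ} {s : ℝ}
    (hf : Compat l k f s) {i : Fin n} (hi : i ≠ l) : Compat l k (pd l i f) s := by
  induction hf with
  | zero h => exact .zero (h.pd_tangential hi)
  | succ h _ ih => exact .succ (h.pd_tangential hi) (ih.congr (pd_comm h.contDiffOn l i))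

theorem Compat.pd_any {k : ℕ} {f : EuclideanSpace ℝ (Fin n) → ℝ} {s : ℝ}
    (hf : Compat l (k + 1) f s) (i : Fin n) : Compat l k (pd l i f) (s * parity l i) := by
  by_cases hi : i = l
  · subst hi
    simpa [parity_self] using hf.pd_normal
  · simpa [parity_of_ne hi] using hf.of_succ.pd_tangential hi

theorem extend_of_nonneg {f : EuclideanSpace ℝ (Fin n) → ℝ} {s : ℝ}
    {x : EuclideanSpace ℝ (Fin n)} (hx : 0 ≤ x l) : extend l s f x = f x := if_pos hx

theorem extend_of_neg {f : EuclideanSpace ℝ (Fin n) → ℝ} {s : ℝ}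
    {x : EuclideanSpace ℝ (Fin n)} (hx : x l < 0) :
    extend l s f x = s * f (mirror l x) := if_neg hx.not_ge

theorem Compat.extend_of_nonpos {k : ℕ} {f : EuclideanSpace ℝ (Fin n) → ℝ} {s : ℝ}
    (hf : Compat l k f s) {x : EuclideanSpace ℝ (Fin n)} (hx : x l ≤ 0) (hx0 : x ≠ 0) :
    extend l s f x = s * f (mirror l x) := by
  rcases hx.lt_or_eq with h | h
  · exact extend_of_neg h
  · rw [extend_of_nonneg h.ge, mirror_self_of_eq_zero h]
    rcases hf.admissible.sign with hs | hs
    · rw [hs, one_mul]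
    · rw [hf.admissible.vanish hs x h hx0, mul_zero]

/-- The derivative of the reflected function. -/
def extendDeriv (l : Fin n) (s : ℝ) (f : EuclideanSpace ℝ (Fin n) → ℝ)
    (x : EuclideanSpace ℝ (Fin n)) : EuclideanSpace ℝ (Fin n) →L[ℝ] ℝ :=
  ∑ i, extend l (s * parity l i) (pd l i f) x • EuclideanSpace.proj i

theorem extendDeriv_single (s : ℝ) (f : EuclideanSpace ℝ (Fin n) → ℝ)
    (x : EuclideanSpace ℝ (Fin n)) (i : Fin n) :
    extendDeriv l s f x (EuclideanSpace.single i 1) = extend l (s * parity l i) (pd l i f) x := by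
  simp [extendDeriv]

theorem clm_ext_single {A B : EuclideanSpace ℝ (Fin n) →L[ℝ] ℝ}
    (h : ∀ i, A (EuclideanSpace.single i 1) = B (EuclideanSpace.single i 1)) : A = B := by
  apply ContinuousLinearMap.coe_injective
  apply (EuclideanSpace.basisFun (Fin n) ℝ).toBasis.ext
  intro i
  simpa using h i

theorem Compat.hasFDerivAt_extend {f : EuclideanSpace ℝ (Fin n) → ℝ} {s : ℝ}
    (hf : Compat l 1 f s) {x : EuclideanSpace ℝ (Fin n)} (hx0 : x ≠ 0) :
    HasFDerivAt (extend l s f) (extendDeriv l s f x) x := by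
  have hup : HasFDerivWithinAt (extend l s f) (extendDeriv l s f x) (upper l) x := by
    by_cases hx : 0 ≤ x l
    · have hxu : x ∈ upper l := ⟨hx, hx0⟩
      have h1 := (differentiableWithinAt_upper hf.contDiffOn hxu).hasFDerivWithinAt
      have h2 : extendDeriv l s f x = fderivWithin ℝ f (upper l) x := by
        apply clm_ext_single
        intro i
        rw [extendDeriv_single, extend_of_nonneg hx]
        rfl
      rw [h2]
      exact h1.congr (fun y hy => extend_of_nonneg hy.1) (extend_of_nonneg hx)
    · apply HasFDerivWithinAt.of_notMem_closure
      intro hc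
      have hcl : IsClosed {y : EuclideanSpace ℝ (Fin n) | 0 ≤ y l} :=
        isClosed_le continuous_const (EuclideanSpace.proj (𝕜 := ℝ) l).continuous
      exact hx (hcl.closure_subset_iff.2 (fun y hy => hy.1) hc)
  have hlow : HasFDerivWithinAt (extend l s f) (extendDeriv l s f x)
      {y | y l ≤ 0 ∧ y ≠ 0} x := by
    by_cases hx : x l ≤ 0
    · have hxu : mirror l x ∈ upper l := mirror_mem_upper hx hx0
      have h1 := (differentiableWithinAt_upper hf.contDiffOn hxu).hasFDerivWithinAt
      have h2 : HasFDerivWithinAt (fun y => s * f (mirror l y))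
          (s • (fderivWithin ℝ f (upper l) (mirror l x)).comp (mirror l))
          {y | y l ≤ 0 ∧ y ≠ 0} x :=
        (h1.comp x (mirror l).hasFDerivWithinAt
          (fun y hy => mirror_mem_upper hy.1 hy.2)).const_mul s
      have h3 : extendDeriv l s f x =
          s • (fderivWithin ℝ f (upper l) (mirror l x)).comp (mirror l) := by
        apply clm_ext_single
        intro i
        rw [extendDeriv_single, (hf.pd_any i).extend_of_nonpos hx hx0]
        simp [mirror_single, pd, mul_assoc]
      rw [h3]
      exact h2.congr (fun y hy => hf.extend_of_nonpos hy.1 hy.2) (hf.extend_of_nonpos hx hx0)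
    · apply HasFDerivWithinAt.of_notMem_closure
      intro hc
      have hcl : IsClosed {y : EuclideanSpace ℝ (Fin n) | y l ≤ 0} :=
        isClosed_le (EuclideanSpace.proj (𝕜 := ℝ) l).continuous continuous_const
      exact hx (hcl.closure_subset_iff.2 (fun y hy => hy.1) hc)
  refine (hup.union hlow).hasFDerivAt ?_
  filter_upwards [isOpen_compl_singleton.mem_nhds hx0] with y hy
  rcases le_total 0 (y l) with h | h
  · exact Or.inl ⟨h, hy⟩
  · exact Or.inr ⟨h, hy⟩

theorem contDiffOn_extend (k : ℕ) {f : EuclideanSpace ℝ (Fin n) → ℝ} {s : ℝ}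
    (hf : ∀ m, Compat l m f s) : ContDiffOn ℝ k (extend l s f) {x | x ≠ 0} := by
  have hd : ∀ {f : EuclideanSpace ℝ (Fin n) → ℝ} {s : ℝ}, (∀ m, Compat l m f s) →
      ∀ x ∈ {x : EuclideanSpace ℝ (Fin n) | x ≠ 0},
        HasFDerivWithinAt (extend l s f) (extendDeriv l s f x) {x | x ≠ 0} x :=
    fun h x hx => ((h 1).hasFDerivAt_extend hx).hasFDerivWithinAt
  induction k generalizing f s with
  | zero =>
    exact contDiffOn_zero.2 fun x hx => (hd hf x hx).continuousWithinAt
  | succ k ih =>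
    have hopen : IsOpen {x : EuclideanSpace ℝ (Fin n) | x ≠ 0} := isOpen_compl_singleton
    push_cast
    rw [contDiffOn_succ_iff_fderiv_of_isOpen hopen]
    refine ⟨fun x hx => (hd hf x hx).differentiableWithinAt, by simp, ?_⟩
    refine ContDiffOn.congr (f := extendDeriv l s f) ?_
      fun x hx => ((hf 1).hasFDerivAt_extend hx).fderiv
    unfold extendDeriv
    refine ContDiffOn.sum fun i _ => ?_
    exact (ih fun m => (hf (m + 1)).pd_any i).smul contDiffOn_const

theorem fderiv_extend_single {f g : EuclideanSpace ℝ (Fin n) → ℝ} {s : ℝ} (hf : Compat l 1 f s)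
    (hg : ∀ x, x ≠ 0 → g x = extend l s f x) {x : EuclideanSpace ℝ (Fin n)} (hx : x ≠ 0)
    (i : Fin n) :
    fderiv ℝ g x (EuclideanSpace.single i 1) = extend l (s * parity l i) (pd l i f) x := by
  have h : g =ᶠ[𝓝 x] extend l s f := by
    filter_upwards [isOpen_compl_singleton.mem_nhds hx] with y hy using hg y hy
  rw [h.fderiv_eq, (hf.hasFDerivAt_extend hx).fderiv, extendDeriv_single]

theorem fderiv_single_eq_pd (f : EuclideanSpace ℝ (Fin n) → ℝ) {x : EuclideanSpace ℝ (Fin n)}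
    (hx : 0 < x l) (i : Fin n) : fderiv ℝ f x (EuclideanSpace.single i 1) = pd l i f x := by
  rw [pd, fderivWithin_of_mem_nhds (upper_mem_nhds hx)]

theorem fderiv_fderiv_single_eq_pd (f : EuclideanSpace ℝ (Fin n) → ℝ)
    {x : EuclideanSpace ℝ (Fin n)} (hx : 0 < x l) (i j : Fin n) :
    fderiv ℝ (fun y => fderiv ℝ f y (EuclideanSpace.single j 1)) x (EuclideanSpace.single i 1) =
      pd l i (pd l j f) x := by
  have ho : IsOpen {y : EuclideanSpace ℝ (Fin n) | 0 < y l} :=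
    isOpen_lt continuous_const (EuclideanSpace.proj (𝕜 := ℝ) l).continuous
  have h : (fun y => fderiv ℝ f y (EuclideanSpace.single j 1)) =ᶠ[𝓝 x] pd l j f := by
    filter_upwards [ho.mem_nhds hx] with y hy using fderiv_single_eq_pd f hy j
  rw [h.fderiv_eq, fderiv_single_eq_pd _ hx]

/-- Smooth solutions of the steady Navier-Stokes equations, up to the boundary. -/
structure IsSolution (l : Fin n) (v : Fin n → EuclideanSpace ℝ (Fin n) → ℝ)
    (p : EuclideanSpace ℝ (Fin n) → ℝ) : Prop where
  smooth_v : ∀ j, ContDiffOn ℝ (⊤ : ℕ∞) (v j) (upper l)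
  smooth_p : ContDiffOn ℝ (⊤ : ℕ∞) p (upper l)
  momentum : ∀ j, ∀ x ∈ upper l,
    -(∑ i, pd l i (pd l i (v j)) x) + (∑ i, v i x * pd l i (v j) x) + pd l j p x = 0
  divergence : ∀ x ∈ upper l, ∑ i, pd l i (v i) x = 0

theorem IsSolution.of_interior {v : Fin n → EuclideanSpace ℝ (Fin n) → ℝ}
    {p : EuclideanSpace ℝ (Fin n) → ℝ}
    (hv : ∀ j, ContDiffOn ℝ (⊤ : ℕ∞) (v j) (upper l))
    (hp : ContDiffOn ℝ (⊤ : ℕ∞) p (upper l))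
    (hNS : ∀ j, ∀ x : EuclideanSpace ℝ (Fin n), 0 < x l →
      -(∑ i, pd l i (pd l i (v j)) x) + (∑ i, v i x * pd l i (v j) x) + pd l j p x = 0)
    (hdiv : ∀ x : EuclideanSpace ℝ (Fin n), 0 < x l → ∑ i, pd l i (v i) x = 0) :
    IsSolution l v p where
  smooth_v := hv
  smooth_p := hp
  momentum j := by
    refine eqOn_upper (g := fun _ => 0) ?_ contDiffOn_const (hNS j)
    exact ((ContDiffOn.sum fun i _ => contDiffOn_pd i (contDiffOn_pd i (hv j))).neg.add
      (ContDiffOn.sum fun i _ => (hv i).mul (contDiffOn_pd i (hv j)))).add (contDiffOn_pd j hp)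
  divergence := by
    refine eqOn_upper (g := fun _ => 0) ?_ contDiffOn_const hdiv
    exact ContDiffOn.sum fun i _ => contDiffOn_pd i (hv i)

theorem IsSolution.compat_normal {v : Fin n → EuclideanSpace ℝ (Fin n) → ℝ}
    {p : EuclideanSpace ℝ (Fin n) → ℝ} (h : IsSolution l v p)
    (hn : ∀ x : EuclideanSpace ℝ (Fin n), x l = 0 → x ≠ 0 → v l x = 0) {k : ℕ}
    (ht : ∀ j, j ≠ l → Compat l k (v j) 1) : Compat l (k + 1) (v l) (-1) := by
  refine .succ ⟨h.smooth_v l, Or.inr rfl, fun _ => hn⟩ ?_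
  rw [neg_neg]
  have h1 : Compat l k (fun x => -∑ i ∈ Finset.univ.erase l, pd l i (v i) x) 1 :=
    (Compat.sum _ (Or.inl rfl) fun i hi =>
      (ht i (Finset.ne_of_mem_erase hi)).pd_tangential (Finset.ne_of_mem_erase hi)).neg
  refine h1.congr fun x hx => ?_
  have := h.divergence x hx
  rw [← Finset.add_sum_erase _ _ (Finset.mem_univ l)] at this
  linarith

theorem IsSolution.compat_transport {v : Fin n → EuclideanSpace ℝ (Fin n) → ℝ} {k : ℕ}
    (hv : ∀ j, Compat l (k + 1) (v j) (parity l j)) (j : Fin n) :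
    Compat l k (fun x => ∑ i, v i x * pd l i (v j) x) (parity l j) := by
  refine Compat.sum _ (parity_cases j) fun i _ => ?_
  have := (hv i).of_succ.mul ((hv j).pd_any i)
  rwa [mul_left_comm, parity_mul_self, mul_one] at this

theorem IsSolution.compat_aux {v : Fin n → EuclideanSpace ℝ (Fin n) → ℝ}
    {p : EuclideanSpace ℝ (Fin n) → ℝ} (h : IsSolution l v p)
    (hn : ∀ x : EuclideanSpace ℝ (Fin n), x l = 0 → x ≠ 0 → v l x = 0)
    (ht : ∀ j, j ≠ l → ∀ x : EuclideanSpace ℝ (Fin n), x l = 0 → x ≠ 0 → pd l l (v j) x = 0)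
    (k : ℕ) : (∀ j, j ≠ l → Compat l (k + 1) (v j) 1) ∧ Compat l k p 1 := by
  induction k with
  | zero =>
    refine ⟨fun j hj => .succ ⟨h.smooth_v j, Or.inl rfl, by norm_num⟩
      (.zero ⟨contDiffOn_pd l (h.smooth_v j), Or.inr rfl, fun _ => ht j hj⟩),
      .zero ⟨h.smooth_p, Or.inl rfl, by norm_num⟩⟩
  | succ k ih =>
    obtain ⟨hvt, hp⟩ := ih
    have hvn := h.compat_normal hn hvt
    have hv : ∀ j, Compat l (k + 1) (v j) (parity l j) := by
      intro j
      by_cases hj : j = l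
      · subst hj; rw [parity_self]; exact hvn.of_succ
      · rw [parity_of_ne hj]; exact hvt j hj
    have htr := IsSolution.compat_transport hv
    constructor
    · intro j hj
      refine .succ (hvt j hj).admissible
        (.succ ⟨contDiffOn_pd l (h.smooth_v j), Or.inr rfl, fun _ => ht j hj⟩ ?_)
      rw [neg_neg]
      have h1 : Compat l k (fun x => (-∑ i ∈ Finset.univ.erase l, pd l i (pd l i (v j)) x) +
          ((∑ i, v i x * pd l i (v j) x) + pd l j p x)) 1 := by
        refine (Compat.sum _ (Or.inl rfl) fun i hi => ?_).neg.add
          (Compat.add ?_ (hp.pd_tangential hj))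
        · have hi := Finset.ne_of_mem_erase hi
          exact ((hvt j hj).of_succ.pd_tangential hi).pd_tangential hi
        · simpa only [parity_of_ne hj] using htr j
      refine h1.congr fun x hx => ?_
      have := h.momentum j x hx
      rw [← Finset.add_sum_erase _ (fun i => pd l i (pd l i (v j)) x) (Finset.mem_univ l)] at this
      linarith
    · refine .succ ⟨h.smooth_p, Or.inl rfl, by norm_num⟩ ?_
      have h1 : Compat l k (fun x => (∑ i, pd l i (pd l i (v l)) x) +
          -∑ i, v i x * pd l i (v l) x) (-1) := by
        refine (Compat.sum _ (Or.inr rfl) fun i _ => ?_).add ?_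
        · have := (hvn.pd_any i).pd_any i
          rwa [mul_assoc, parity_mul_self, mul_one] at this
        · have := (htr l).neg
          rwa [parity_self] at this
      refine h1.congr fun x hx => ?_
      have := h.momentum l x hx
      linarith

theorem IsSolution.compat {v : Fin n → EuclideanSpace ℝ (Fin n) → ℝ}
    {p : EuclideanSpace ℝ (Fin n) → ℝ} (h : IsSolution l v p)
    (hn : ∀ x : EuclideanSpace ℝ (Fin n), x l = 0 → x ≠ 0 → v l x = 0)
    (ht : ∀ j, j ≠ l → ∀ x : EuclideanSpace ℝ (Fin n), x l = 0 → x ≠ 0 → pd l l (v j) x = 0)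
    (k : ℕ) : (∀ j, Compat l k (v j) (parity l j)) ∧ Compat l k p 1 := by
  obtain ⟨hvt, hp⟩ := h.compat_aux hn ht k
  refine ⟨fun j => ?_, hp⟩
  by_cases hj : j = l
  · subst hj
    rw [parity_self]
    exact (h.compat_normal hn hvt).of_succ.of_succ
  · rw [parity_of_ne hj]
    exact (hvt j hj).of_succ

theorem contDiffOn_top_extend {f : EuclideanSpace ℝ (Fin n) → ℝ} {s : ℝ}
    (hf : ∀ m, Compat l m f s) : ContDiffOn ℝ (⊤ : ℕ∞) (extend l s f) {x | x ≠ 0} :=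
  contDiffOn_infty.2 fun k => contDiffOn_extend k hf

theorem IsSolution.momentum_extend {v w : Fin n → EuclideanSpace ℝ (Fin n) → ℝ}
    {p q : EuclideanSpace ℝ (Fin n) → ℝ} (h : IsSolution l v p)
    (hv : ∀ k j, Compat l k (v j) (parity l j)) (hp : Compat l 1 p 1)
    (hw : ∀ j x, x ≠ 0 → w j x = extend l (parity l j) (v j) x)
    (hq : ∀ x, x ≠ 0 → q x = extend l 1 p x)
    {x : EuclideanSpace ℝ (Fin n)} (hx : x ≠ 0) (j : Fin n) :
    -(∑ i, fderiv ℝ (fun y => fderiv ℝ (w j) y (EuclideanSpace.single i 1)) x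
        (EuclideanSpace.single i 1)) +
      (∑ i, w i x * fderiv ℝ (w j) x (EuclideanSpace.single i 1)) +
      fderiv ℝ q x (EuclideanSpace.single j 1) = 0 := by
  have h1 : ∀ i y, y ≠ 0 → fderiv ℝ (w j) y (EuclideanSpace.single i 1) =
      extend l (parity l j * parity l i) (pd l i (v j)) y := fun i y hy =>
    fderiv_extend_single (hv 1 j) (hw j) hy i
  have h2 : ∀ i, fderiv ℝ (fun y => fderiv ℝ (w j) y (EuclideanSpace.single i 1)) x
      (EuclideanSpace.single i 1) = extend l (parity l j) (pd l i (pd l i (v j))) x := by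
    intro i
    rw [fderiv_extend_single ((hv 2 j).pd_any i) (h1 i) hx i, mul_assoc, parity_mul_self, mul_one]
  rw [fderiv_extend_single hp hq hx j, one_mul]
  simp only [h1 _ x hx, h2, hw _ x hx]
  rcases le_or_gt 0 (x l) with hl | hl
  · simp only [extend_of_nonneg hl]
    exact h.momentum j x ⟨hl, hx⟩
  · simp only [extend_of_neg hl]
    have h3 : ∀ i, parity l i * v i (mirror l x) *
        (parity l j * parity l i * pd l i (v j) (mirror l x)) =
        parity l j * (v i (mirror l x) * pd l i (v j) (mirror l x)) := by
      intro i
      linear_combination (parity l j * v i (mirror l x) * pd l i (v j) (mirror l x)) *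
        parity_mul_self (l := l) i
    simp only [h3, ← Finset.mul_sum]
    linear_combination parity l j * h.momentum j _ (mirror_mem_upper hl.le hx)

theorem IsSolution.divergence_extend {v w : Fin n → EuclideanSpace ℝ (Fin n) → ℝ}
    {p : EuclideanSpace ℝ (Fin n) → ℝ} (h : IsSolution l v p)
    (hv : ∀ j, Compat l 1 (v j) (parity l j))
    (hw : ∀ j x, x ≠ 0 → w j x = extend l (parity l j) (v j) x)
    {x : EuclideanSpace ℝ (Fin n)} (hx : x ≠ 0) :
    ∑ i, fderiv ℝ (w i) x (EuclideanSpace.single i 1) = 0 := by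
  simp only [fun i => fderiv_extend_single (hv i) (hw i) hx i, parity_mul_self]
  rcases le_or_gt 0 (x l) with hl | hl
  · simp only [extend_of_nonneg hl]
    exact h.divergence x ⟨hl, hx⟩
  · simp only [extend_of_neg hl, one_mul]
    exact h.divergence _ (mirror_mem_upper hl.le hx)

theorem norm_le_div_on_upper {u : EuclideanSpace ℝ (Fin n) → EuclideanSpace ℝ (Fin n)}
    (hu : ContinuousOn u (upper l)) {C : ℝ}
    (h : ∀ x : EuclideanSpace ℝ (Fin n), 0 < x l → x ≠ 0 → ‖u x‖ ≤ C / ‖x‖)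
    {x : EuclideanSpace ℝ (Fin n)} (hx : x ∈ upper l) : ‖u x‖ ≤ C / ‖x‖ := by
  have hsub : {y : EuclideanSpace ℝ (Fin n) | 0 < y l} ⊆ upper l :=
    fun _ hy => mem_of_mem_nhds (upper_mem_nhds hy)
  have hc : ContinuousWithinAt (fun y => C / ‖y‖) {y : EuclideanSpace ℝ (Fin n) | 0 < y l} x :=
    (continuousAt_const.div continuous_norm.continuousAt
      (norm_ne_zero_iff.2 hx.2)).continuousWithinAt
  exact ContinuousWithinAt.closure_le (upper_subset_closure hx) ((hu x hx).mono hsub).norm hc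
    fun y hy => h y hy (hsub hy).2

end SlipReflection

end

open Set SlipReflection in
/-- **Reflection of Navier-slip solutions across the boundary, n ≥ 4.**
Let `(u, p)` be a smooth solution of the steady Navier-Stokes equations on
`Ω = ℝⁿ₊ \ {0}` with `|u(x)| ≤ C/|x|`, extending smoothly up to `∂ℝⁿ₊ \ {0}` and
satisfying there the Navier slip conditions `uₙ = 0` and `∂ₙuᵢ = 0` for `i ≠ n`.
Define `ũ` on `ℝⁿ \ {0}` by even reflection of the tangential components and odd
reflection of the normal component, and `p̃(x', xₙ) = p(x', |xₙ|)`.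
Then `(ũ, p̃)` is a smooth solution of the steady Navier-Stokes equations on
`ℝⁿ \ {0}` and `|ũ(x)| ≤ C/|x|` for all `x ≠ 0`. -/
theorem steady_NS_Navier_slip_reflection {n : ℕ} (hn : 4 ≤ n)
    (last : Fin n) (hlast : (last : ℕ) = n - 1)
    (u ut : EuclideanSpace ℝ (Fin n) → EuclideanSpace ℝ (Fin n))
    (p pt : EuclideanSpace ℝ (Fin n) → ℝ)
    -- `u`, `p` are smooth up to the boundary, away from the origin
    (hu : ContDiffOn ℝ (⊤ : ℕ∞) u ({x : EuclideanSpace ℝ (Fin n) | 0 ≤ x last} \ {0}))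
    (hp : ContDiffOn ℝ (⊤ : ℕ∞) p ({x : EuclideanSpace ℝ (Fin n) | 0 ≤ x last} \ {0}))
    -- steady Navier-Stokes equations on Ω = ℝⁿ₊ \ {0}
    (hNS : ∀ x : EuclideanSpace ℝ (Fin n), 0 < x last → x ≠ 0 → ∀ j : Fin n,
      -(∑ i : Fin n, fderiv ℝ (fun y => fderiv ℝ (fun z => u z j) y
            (EuclideanSpace.single i 1)) x (EuclideanSpace.single i 1)) +
        (∑ i : Fin n, u x i * fderiv ℝ (fun z => u z j) x (EuclideanSpace.single i 1)) +
        fderiv ℝ p x (EuclideanSpace.single j 1) = 0)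
    (hdiv : ∀ x : EuclideanSpace ℝ (Fin n), 0 < x last → x ≠ 0 →
      ∑ i : Fin n, fderiv ℝ (fun z => u z i) x (EuclideanSpace.single i 1) = 0)
    -- Navier slip boundary conditions on ∂ℝⁿ₊ \ {0}
    (hslip₁ : ∀ x : EuclideanSpace ℝ (Fin n), x last = 0 → x ≠ 0 → u x last = 0)
    (hslip₂ : ∀ x : EuclideanSpace ℝ (Fin n), x last = 0 → x ≠ 0 → ∀ i : Fin n, i ≠ last →
      fderivWithin ℝ (fun z => u z i) {y : EuclideanSpace ℝ (Fin n) | 0 ≤ y last} x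
        (EuclideanSpace.single last 1) = 0)
    (C : ℝ) (hC : 0 < C)
    (hbound : ∀ x : EuclideanSpace ℝ (Fin n), 0 < x last → x ≠ 0 → ‖u x‖ ≤ C / ‖x‖)
    -- definition of the reflected velocity `ũ`:
    -- on the closed upper half space it agrees with `u`,
    (hut_pos : ∀ x : EuclideanSpace ℝ (Fin n), 0 ≤ x last → x ≠ 0 → ut x = u x)
    -- below the boundary, if `y` is the mirror image of `x`, then the tangential
    -- components are reflected evenly and the normal component oddly,
    (hut_neg : ∀ x y : EuclideanSpace ℝ (Fin n), x last < 0 →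
      (∀ i : Fin n, i ≠ last → y i = x i) → y last = -(x last) →
      (∀ i : Fin n, i ≠ last → ut x i = u y i) ∧ ut x last = -(u y last))
    -- definition of the reflected pressure `p̃(x', xₙ) = p(x', |xₙ|)`:
    (hpt_pos : ∀ x : EuclideanSpace ℝ (Fin n), 0 ≤ x last → x ≠ 0 → pt x = p x)
    (hpt_neg : ∀ x y : EuclideanSpace ℝ (Fin n), x last < 0 →
      (∀ i : Fin n, i ≠ last → y i = x i) → y last = -(x last) → pt x = p y) :
    -- conclusion: `(ũ, p̃)` is a smooth solution on `ℝⁿ \ {0}` with the same bound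
    ContDiffOn ℝ (⊤ : ℕ∞) ut {x : EuclideanSpace ℝ (Fin n) | x ≠ 0} ∧
    ContDiffOn ℝ (⊤ : ℕ∞) pt {x : EuclideanSpace ℝ (Fin n) | x ≠ 0} ∧
    (∀ x : EuclideanSpace ℝ (Fin n), x ≠ 0 → ∀ j : Fin n,
      -(∑ i : Fin n, fderiv ℝ (fun y => fderiv ℝ (fun z => ut z j) y
            (EuclideanSpace.single i 1)) x (EuclideanSpace.single i 1)) +
        (∑ i : Fin n, ut x i * fderiv ℝ (fun z => ut z j) x (EuclideanSpace.single i 1)) +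
        fderiv ℝ pt x (EuclideanSpace.single j 1) = 0) ∧
    (∀ x : EuclideanSpace ℝ (Fin n), x ≠ 0 →
      ∑ i : Fin n, fderiv ℝ (fun z => ut z i) x (EuclideanSpace.single i 1) = 0) ∧
    (∀ x : EuclideanSpace ℝ (Fin n), x ≠ 0 → ‖ut x‖ ≤ C / ‖x‖) := by
  have hv : ∀ j, ContDiffOn ℝ (⊤ : ℕ∞) (fun z => u z j) (upper last) := contDiffOn_euclidean.1 hu
  have hsol : IsSolution last (fun j z => u z j) p := by
    have hne : ∀ x : EuclideanSpace ℝ (Fin n), 0 < x last → x ≠ 0 :=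
      fun x hx => (mem_of_mem_nhds (upper_mem_nhds hx)).2
    refine IsSolution.of_interior hv hp (fun j x hx => ?_) (fun x hx => ?_)
    · have := hNS x hx (hne x hx) j
      simpa only [fderiv_fderiv_single_eq_pd _ hx, fderiv_single_eq_pd _ hx] using this
    · have := hdiv x hx (hne x hx)
      simpa only [fderiv_single_eq_pd _ hx] using this
  have hcompat := hsol.compat hslip₁ fun j hj x hx hx0 => by
    rw [← hslip₂ x hx hx0 j hj, pd, upper, sdiff_eq,
      fderivWithin_inter (isOpen_compl_singleton.mem_nhds hx0)]
  have hmirror : ∀ x : EuclideanSpace ℝ (Fin n),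
      (∀ i, i ≠ last → mirror last x i = x i) ∧ mirror last x last = -x last := fun x =>
    ⟨fun i hi => by rw [mirror_apply, parity_of_ne hi, one_mul],
      by rw [mirror_apply, parity_self, neg_one_mul]⟩
  have hut_low : ∀ x : EuclideanSpace ℝ (Fin n), x last < 0 →
      ut x = mirror last (u (mirror last x)) := by
    intro x hx
    obtain ⟨h1, h2⟩ := hut_neg x _ hx (hmirror x).1 (hmirror x).2
    ext i
    by_cases hi : i = last
    · rw [hi, h2, (hmirror _).2]
    · rw [h1 i hi, (hmirror _).1 i hi]
  have hw : ∀ j x, x ≠ 0 → ut x j = extend last (parity last j) (fun z => u z j) x := by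
    intro j x hx
    rcases le_or_gt 0 (x last) with hl | hl
    · rw [extend_of_nonneg hl, hut_pos x hl hx]
    · rw [extend_of_neg hl, hut_low x hl, mirror_apply]
  have hq : ∀ x, x ≠ 0 → pt x = extend last 1 p x := by
    intro x hx
    rcases le_or_gt 0 (x last) with hl | hl
    · rw [extend_of_nonneg hl, hpt_pos x hl hx]
    · rw [extend_of_neg hl, one_mul, hpt_neg x _ hl (hmirror x).1 (hmirror x).2]
  refine ⟨?_, ?_, ?_, ?_, ?_⟩
  · exact contDiffOn_euclidean.2 fun j =>
      (contDiffOn_top_extend fun m => (hcompat m).1 j).congr (hw j)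
  · exact (contDiffOn_top_extend fun m => (hcompat m).2).congr hq
  · exact fun x hx j => hsol.momentum_extend (w := fun j z => ut z j)
      (fun k => (hcompat k).1) (hcompat 1).2 hw hq hx j
  · exact fun x hx => hsol.divergence_extend (w := fun j z => ut z j) (hcompat 1).1 hw hx
  · intro x hx
    rcases le_or_gt 0 (x last) with hl | hl
    · rw [hut_pos x hl hx]
      exact norm_le_div_on_upper hu.continuousOn hbound ⟨hl, hx⟩
    · rw [hut_low x hl, norm_mirror, ← norm_mirror (l := last) x]
      exact norm_le_div_on_upper hu.continuousOn hbound (mirror_mem_upper hl.le hx)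
end
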